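/- arXiv:1409.2218 — 2 statements merged into one kernel-verified Lean document; each statement's English description precedes it below -/
import Mathlib

section
/- Let S be a finite nonempty set of primes. There exists a finite simple graph H with vertex set V and edge set E, together with an injective map q : V → ℚ such that q(i) − q(j) is an S-unit for every edge {i, j} ∈ E, but there is NO injective map r : V → ℚ such that for all distinct i, j ∈ V one has {i, j} ∈ E if and only if r(i) − r(j) is an S-unit. (In other words, some finite subgraph of the S-unit graph is not an induced subgraph of it.) -/
/-- A rational number `u` is an `S`-unit if `u ≠ 0` and every prime dividing
its numerator or its denominator (in lowest terms) lies in `S`. -/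
def IsSUnit (S : Finset ℕ) (u : ℚ) : Prop :=
  u ≠ 0 ∧ ∀ p : ℕ, p.Prime → ((p : ℤ) ∣ u.num ∨ p ∣ u.den) → p ∈ S

lemma padicValRat_ne_zero_iff {p : ℕ} (hp : p.Prime) {u : ℚ} (hu : u ≠ 0) :
    padicValRat p u ≠ 0 ↔ ((p : ℤ) ∣ u.num ∨ p ∣ u.den) := by
  have := Fact.mk hp
  have hn : u.num ≠ 0 := Rat.num_ne_zero.2 hu
  have hnum : (p : ℤ) ∣ u.num ↔ padicValInt p u.num ≠ 0 := by
    rw [Int.natCast_dvd, padicValInt, dvd_iff_padicValNat_ne_zero (by simpa using hn)]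
  have hden := dvd_iff_padicValNat_ne_zero (p := p) u.den_nz
  have hco : ¬ ((p : ℤ) ∣ u.num ∧ p ∣ u.den) := fun h ↦
    Nat.not_coprime_of_dvd_of_dvd hp.one_lt (Int.natCast_dvd.1 h.1) h.2 u.reduced
  rw [hnum, hden] at hco ⊢
  rw [padicValRat_def]
  omega

lemma eq_one_or_neg_one_of_padicValRat_eq_zero {u : ℚ} (hu : u ≠ 0)
    (h : ∀ p : ℕ, p.Prime → padicValRat p u = 0) : u = 1 ∨ u = -1 := by
  have key : ∀ p : ℕ, p.Prime → ¬ ((p : ℤ) ∣ u.num ∨ p ∣ u.den) := fun p hp hd ↦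
    (padicValRat_ne_zero_iff hp hu).2 hd (h p hp)
  have hden : u.den = 1 := by
    by_contra hne
    obtain ⟨p, hp, hd⟩ := Nat.exists_prime_and_dvd hne
    exact key p hp (Or.inr hd)
  have hnum : u.num.natAbs = 1 := by
    by_contra hne
    obtain ⟨p, hp, hd⟩ := Nat.exists_prime_and_dvd hne
    exact key p hp (Or.inl (Int.natCast_dvd.2 hd))
  rw [← Rat.coe_int_num_of_den_eq_one hden]
  rcases Int.natAbs_eq_iff.1 hnum with h | h <;> simp [h]

lemma padicValRat_prod_zpow {S : Finset ℕ} (hP : ∀ p ∈ S, p.Prime) (k : ℕ → ℤ) {p : ℕ}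
    (hp : p.Prime) :
    padicValRat p (∏ l ∈ S, (l : ℚ) ^ k l) = if p ∈ S then k p else 0 := by
  have := Fact.mk hp
  induction S using Finset.induction_on with
  | empty => simp
  | insert q S hq ih =>
    have hP' : ∀ p ∈ S, p.Prime := fun p hp ↦ hP p (Finset.mem_insert_of_mem hp)
    have hqp : q.Prime := hP q (Finset.mem_insert_self _ _)
    have hq0 : (q : ℚ) ≠ 0 := mod_cast hqp.ne_zero
    have hS0 : ∏ l ∈ S, (l : ℚ) ^ k l ≠ 0 := Finset.prod_ne_zero_iff.2 fun l hl ↦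
      zpow_ne_zero _ (mod_cast (hP' l hl).ne_zero)
    have hqv : padicValRat p (q : ℚ) = if p = q then 1 else 0 := by
      rw [padicValRat.of_nat]
      split_ifs with h
      · subst h; simp [hp.one_lt]
      · have := Fact.mk hqp
        exact mod_cast padicValNat_primes h
    rw [Finset.prod_insert hq, padicValRat.mul (zpow_ne_zero _ hq0) hS0, ih hP',
      padicValRat.zpow, hqv]
    rcases eq_or_ne p q with rfl | h
    · simp [hq]
    · simp [h]

lemma isSUnit_iff {S : Finset ℕ} {u : ℚ} :
    IsSUnit S u ↔ u ≠ 0 ∧ ∀ p : ℕ, p.Prime → p ∉ S → padicValRat p u = 0 := by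
  refine and_congr_right fun hu ↦ forall₂_congr fun p hp ↦ ?_
  rw [← padicValRat_ne_zero_iff hp hu]
  tauto

lemma isSUnit_iff_eq_prod {S : Finset ℕ} (hP : ∀ p ∈ S, p.Prime) {u : ℚ} (hu : u ≠ 0) :
    IsSUnit S u ↔ u = ∏ l ∈ S, (l : ℚ) ^ padicValRat l u ∨
      u = - ∏ l ∈ S, (l : ℚ) ^ padicValRat l u := by
  set t := ∏ l ∈ S, (l : ℚ) ^ padicValRat l u with ht
  have ht0 : t ≠ 0 := Finset.prod_ne_zero_iff.2 fun l hl ↦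
    zpow_ne_zero _ (mod_cast (hP l hl).ne_zero)
  have hval : ∀ p : ℕ, p.Prime → padicValRat p t = if p ∈ S then padicValRat p u else 0 :=
    fun p hp ↦ padicValRat_prod_zpow hP _ hp
  rw [isSUnit_iff]
  constructor
  · rintro ⟨-, h⟩
    have := eq_one_or_neg_one_of_padicValRat_eq_zero (div_ne_zero hu ht0) fun p hp ↦ by
      have := Fact.mk hp
      rw [padicValRat.div hu ht0, hval p hp]
      split_ifs with hpS
      · simp
      · simp [h p hp hpS]
    rwa [div_eq_iff ht0, div_eq_iff ht0, one_mul, neg_one_mul] at this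
  · intro h
    refine ⟨hu, fun p hp hpS ↦ ?_⟩
    have h' : padicValRat p u = padicValRat p t := by
      rcases h with h | h
      · rw [← h]
      · rw [h, padicValRat.neg]
    rw [h', hval p hp, if_neg hpS]

lemma MvPolynomial.finrank_restrictDegree_le (σ K : Type*) [Fintype σ] [Field K] (D : ℕ) :
    Module.finrank K (MvPolynomial.restrictDegree σ K D) ≤ (D + 1) ^ Fintype.card σ := by
  classical
  have hcard : Module.finrank K (restrictDegree σ K D) = Nat.card {n : σ →₀ ℕ | ∀ i, n i ≤ D} :=
    Module.finrank_eq_nat_card_basis (basisRestrictSupport K {n : σ →₀ ℕ | ∀ i, n i ≤ D})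
  rw [hcard]
  let φ : {n : σ →₀ ℕ | ∀ i, n i ≤ D} → σ → Fin (D + 1) :=
    fun n i ↦ ⟨n.1 i, Nat.lt_succ_of_le (n.2 i)⟩
  have hφ : Function.Injective φ := fun m n h ↦ by
    ext i
    simpa [φ] using congrFun h i
  simpa using Nat.card_le_card_of_injective φ hφ

/-- A family of polynomials has few zero patterns. -/
lemma MvPolynomial.card_zero_patterns_le {σ K ι : Type*} [Fintype σ] [Field K] [DecidableEq ι]
    (f : ι → MvPolynomial σ K) (d : ℕ) (hf : ∀ i v, (f i).degreeOf v ≤ d) (E : Finset ι)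
    (P : Finset (Finset ι)) (hPE : ∀ T ∈ P, T ⊆ E)
    (hP : ∀ T ∈ P, ∃ a : σ → K, ∀ e ∈ E, e ∈ T ↔ MvPolynomial.eval a (f e) = 0) :
    P.card ≤ (d * E.card + 1) ^ Fintype.card σ := by
  classical
  choose! a ha using hP
  let g : Finset ι → MvPolynomial σ K := fun T ↦ ∏ e ∈ E \ T, f e
  have hg : ∀ T, g T ∈ restrictDegree σ K (d * E.card) := fun T ↦ by
    rw [mem_restrictDegree]
    intro s hs i
    calc s i ≤ (g T).degreeOf i := degreeOf_le_iff.1 le_rfl s hs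
      _ ≤ ∑ e ∈ E \ T, (f e).degreeOf i := degreeOf_prod_le _ _ _
      _ ≤ (E \ T).card • d := Finset.sum_le_card_nsmul _ _ _ fun e _ ↦ hf e i
      _ ≤ d * E.card := by
        rw [smul_eq_mul, mul_comm]
        exact Nat.mul_le_mul_left _ (Finset.card_le_card Finset.sdiff_subset)
  have heval : ∀ T ∈ P, ∀ U ∈ P, eval (a T) (g U) ≠ 0 ↔ T ⊆ U := fun T hT U hU ↦ by
    simp only [g, map_prod, Finset.prod_ne_zero_iff, Finset.mem_sdiff]
    constructor
    · intro h e he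
      by_contra heU
      exact h e ⟨hPE T hT he, heU⟩ ((ha T hT e (hPE T hT he)).1 he)
    · rintro h e ⟨heE, heU⟩ h0
      exact heU (h ((ha T hT e heE).2 h0))
  have hli : LinearIndependent K (fun T : P ↦ (⟨g T, hg T⟩ : restrictDegree σ K (d * E.card))) := by
    apply LinearIndependent.of_comp (restrictDegree σ K (d * E.card)).subtype
    rw [Fintype.linearIndependent_iff]
    intro c hc
    by_contra! hne
    obtain ⟨T, hT, hmax⟩ := Finset.exists_max_image
      (Finset.univ.filter fun T : P ↦ c T ≠ 0) (fun T ↦ T.1.card)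
      (by obtain ⟨T, hT⟩ := hne; exact ⟨T, by simpa using hT⟩)
    rw [Finset.mem_filter] at hT
    have h0 := congrArg (eval (a T)) hc
    simp only [Function.comp_apply, Submodule.subtype_apply, map_sum, smul_eval, map_zero] at h0
    rw [Finset.sum_eq_single T] at h0
    · exact (mul_ne_zero hT.2 ((heval T T.2 T T.2).2 subset_rfl)) h0
    · intro U _ hUT
      by_cases hcU : c U = 0
      · simp [hcU]
      · by_contra hU
        have hTU := (heval T T.2 U U.2).1 (right_ne_zero_of_mul hU)
        exact hUT (Subtype.ext (Finset.eq_of_subset_of_card_le hTU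
          (hmax U (by simpa using hcU))).symm)
    · simp
  have := hli.fintype_card_le_finrank
  rw [Fintype.card_coe] at this
  exact this.trans (finrank_restrictDegree_le _ _ _)

/-- The position at which an ultrametric on `Fin N` attains its value on the pair `(x, y)`:
`c.1` sends a point to a nearest earlier point, and `c.2` ranks the corresponding values. -/
def ultrametricNode {N : ℕ} (c : (Fin N → Fin N) × (Fin N → Fin N)) (x y : Fin N) : Fin N :=
  if y < x then
    if _h : c.1 x < x ∧ c.1 x ≠ y then
      if c.2 x ≤ c.2 (ultrametricNode c (c.1 x) y) then x else ultrametricNode c (c.1 x) y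
    else x
  else
    if _h : c.1 y < y ∧ c.1 y ≠ x then
      if c.2 y ≤ c.2 (ultrametricNode c x (c.1 y)) then y else ultrametricNode c x (c.1 y)
    else y
termination_by x.val + y.val
decreasing_by all_goals omega

lemma exists_rank {N : ℕ} (t : Fin N → ℤ) :
    ∃ ρ : Fin N → Fin N, ∀ x y, ρ x ≤ ρ y ↔ t x ≤ t y := by
  refine ⟨fun x ↦ ⟨(Finset.univ.filter fun b ↦ t b < t x).card, ?_⟩, fun x y ↦ ?_⟩
  · exact (Finset.card_lt_univ_of_notMem (x := x) (by simp)).trans_eq (Fintype.card_fin N)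
  · rw [Fin.mk_le_mk]
    constructor
    · intro h
      by_contra! hlt
      refine h.not_gt (Finset.card_lt_card ⟨fun b hb ↦ ?_, fun hsub ↦ ?_⟩)
      · simp only [Finset.mem_filter, Finset.mem_univ, true_and] at hb ⊢
        exact hb.trans hlt
      · simpa using hsub (show y ∈ Finset.univ.filter fun b ↦ t b < t x by simpa using hlt)
    · intro h
      refine Finset.card_le_card fun b hb ↦ ?_
      simp only [Finset.mem_filter, Finset.mem_univ, true_and] at hb ⊢
      exact hb.trans_le h

/-- An ultrametric on `Fin N` is described by `N` values and a combinatorial code. -/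
lemma exists_ultrametricNode {N : ℕ} (v : Fin N → Fin N → ℤ) (hsymm : ∀ x y, v x y = v y x)
    (hv : ∀ x y z, x ≠ z → min (v x y) (v y z) ≤ v x z) :
    ∃ (c : (Fin N → Fin N) × (Fin N → Fin N)) (t : Fin N → ℤ),
      ∀ x y, x ≠ y → v x y = t (ultrametricNode c x y) := by
  have hnear : ∀ x : Fin N, ∃ z, ∀ y < x, z < x ∧ v x y ≤ v x z := fun x ↦ by
    by_cases hx : ∃ y, y < x
    · obtain ⟨z, hz, hmax⟩ := Finset.exists_max_image (Finset.univ.filter (· < x)) (v x)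
        (by obtain ⟨y, hy⟩ := hx; exact ⟨y, by simpa using hy⟩)
      exact ⟨z, fun y hy ↦ ⟨by simpa using hz, hmax y (by simpa using hy)⟩⟩
    · exact ⟨x, fun y hy ↦ absurd ⟨y, hy⟩ hx⟩
  choose π hπ using hnear
  obtain ⟨ρ, hρ⟩ := exists_rank fun x ↦ v x (π x)
  refine ⟨(π, ρ), fun x ↦ v x (π x), ?_⟩
  have hstep : ∀ x y, y < x → π x ≠ y → v x y = min (v x (π x)) (v (π x) y) := fun x y hyx hne ↦ by
    have h1 := (hπ x y hyx).2
    have h2 := hv x (π x) y hyx.ne'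
    have h3 := hv (π x) x y hne
    rw [hsymm (π x) x] at h3
    omega
  have main : ∀ n : ℕ, ∀ x y : Fin N, x.val + y.val = n → x ≠ y →
      v x y = v (ultrametricNode (π, ρ) x y) (π (ultrametricNode (π, ρ) x y)) := by
    intro n
    induction n using Nat.strong_induction_on with
    | _ n ih =>
      intro x y hn hxy
      rw [ultrametricNode]
      by_cases hyx : y < x
      · have hlt := (hπ x y hyx).1
        rw [if_pos hyx]
        by_cases hne : π x = y
        · rw [dif_neg (by simp [hne])]
          rw [hne]
        · rw [dif_pos ⟨hlt, hne⟩, hstep x y hyx hne,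
            ih _ (by rw [← hn]; exact Nat.add_lt_add_right hlt _) (π x) y rfl hne]
          split_ifs with h
          · exact min_eq_left ((hρ _ _).1 h)
          · exact min_eq_right (le_of_not_ge fun h' ↦ h ((hρ _ _).2 h'))
      · have hxy' : x < y := lt_of_le_of_ne (not_lt.1 hyx) hxy
        have hlt := (hπ y x hxy').1
        rw [if_neg hyx, hsymm x y]
        by_cases hne : π y = x
        · rw [dif_neg (by simp [hne])]
          rw [hne]
        · rw [dif_pos ⟨hlt, hne⟩, hstep y x hxy' hne, hsymm (π y) x,
            ih _ (by rw [← hn]; exact Nat.add_lt_add_left hlt _) x (π y) rfl (Ne.symm hne)]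
          split_ifs with h
          · exact min_eq_left ((hρ _ _).1 h)
          · exact min_eq_right (le_of_not_ge fun h' ↦ h ((hρ _ _).2 h'))
  exact fun x y hxy ↦ main _ x y rfl hxy

open MvPolynomial in
/-- Its zeros at a point configuration are the pairs whose difference is an `S`-unit. -/
noncomputable def sUnitPolynomial (S : Finset ℕ) {N : ℕ}
    (c : S → (Fin N → Fin N) × (Fin N → Fin N)) (e : Fin N × Fin N) :
    MvPolynomial (Fin N ⊕ S × Fin N) ℚ :=
  (X (Sum.inl e.1) - X (Sum.inl e.2)) ^ 2 -
    ∏ l : S, X (Sum.inr (l, ultrametricNode (c l) e.1 e.2)) ^ 2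

open MvPolynomial in
lemma degreeOf_sUnitPolynomial_le (S : Finset ℕ) {N : ℕ}
    (c : S → (Fin N → Fin N) × (Fin N → Fin N)) (e : Fin N × Fin N) (v : Fin N ⊕ S × Fin N) :
    (sUnitPolynomial S c e).degreeOf v ≤ 2 * S.card + 2 := by
  classical
  have hX : ∀ w : Fin N ⊕ S × Fin N, (X w : MvPolynomial _ ℚ).degreeOf v ≤ 1 := fun w ↦ by
    rw [degreeOf_X]
    split_ifs <;> simp
  refine (degreeOf_sub_le _ _ _).trans (max_le ?_ ?_)
  · refine (degreeOf_pow_le _ _ _).trans ?_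
    have := (degreeOf_sub_le v (X (Sum.inl e.1) : MvPolynomial _ ℚ) (X (Sum.inl e.2))).trans
      (max_le (hX _) (hX _))
    omega
  · refine (degreeOf_prod_le _ _ _).trans ?_
    have := Finset.sum_le_card_nsmul (Finset.univ : Finset S)
      (fun l ↦ (X (Sum.inr (l, ultrametricNode (c l) e.1 e.2)) ^ 2 :
        MvPolynomial (Fin N ⊕ S × Fin N) ℚ).degreeOf v) 2 fun l _ ↦ by
      refine (degreeOf_pow_le _ _ _).trans ?_
      have := hX (Sum.inr (l, ultrametricNode (c l) e.1 e.2))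
      omega
    rw [Finset.card_univ, Fintype.card_coe, smul_eq_mul] at this
    omega

lemma exists_sUnitPolynomial {S : Finset ℕ} (hP : ∀ p ∈ S, p.Prime) {N : ℕ} {r : Fin N → ℚ}
    (hr : Function.Injective r) :
    ∃ (c : S → (Fin N → Fin N) × (Fin N → Fin N)) (a : Fin N ⊕ S × Fin N → ℚ),
      ∀ e : Fin N × Fin N, e.1 ≠ e.2 →
        (IsSUnit S (r e.1 - r e.2) ↔ MvPolynomial.eval a (sUnitPolynomial S c e) = 0) := by
  have h : ∀ l : S, ∃ (c : (Fin N → Fin N) × (Fin N → Fin N)) (t : Fin N → ℤ),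
      ∀ x y, x ≠ y → padicValRat l (r x - r y) = t (ultrametricNode c x y) := fun l ↦ by
    have := Fact.mk (hP l l.2)
    refine exists_ultrametricNode (fun x y ↦ padicValRat l (r x - r y)) (fun x y ↦ ?_)
      fun x y z hxz ↦ ?_
    · rw [← padicValRat.neg, neg_sub]
    · have h0 : (r x - r y) + (r y - r z) ≠ 0 := by
        rw [sub_add_sub_cancel]
        exact sub_ne_zero.2 (hr.ne hxz)
      simpa using padicValRat.min_le_padicValRat_add (p := l) h0
  choose c t ht using h
  refine ⟨c, Sum.elim r fun w ↦ (w.1 : ℚ) ^ t w.1 w.2, fun e he ↦ ?_⟩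
  rw [isSUnit_iff_eq_prod hP (sub_ne_zero.2 (hr.ne he)), ← sq_eq_sq_iff_eq_or_eq_neg]
  simp only [sUnitPolynomial, map_sub, map_pow, map_prod, MvPolynomial.eval_X, Sum.elim_inl,
    Sum.elim_inr]
  rw [sub_eq_zero, Finset.prod_pow, ← Finset.prod_coe_sort S]
  simp only [ht _ _ _ he]

/-- If every set of edges of a graph is cut out by an injective configuration, then the graph has
few edges. -/
lemma two_pow_card_edges_le {S : Finset ℕ} (hP : ∀ p ∈ S, p.Prime) {N : ℕ}
    (E : Finset (Fin N × Fin N)) (hE : ∀ e ∈ E, e.1 ≠ e.2)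
    (h : ∀ T ⊆ E, ∃ r : Fin N → ℚ, Function.Injective r ∧
      ∀ e ∈ E, e ∈ T ↔ IsSUnit S (r e.1 - r e.2)) :
    2 ^ E.card ≤ ((2 * S.card + 2) * E.card + 1) ^ (N + S.card * N) *
      (N ^ N * N ^ N) ^ S.card := by
  classical
  have h' : ∀ T ⊆ E, ∃ (c : S → (Fin N → Fin N) × (Fin N → Fin N))
      (a : Fin N ⊕ S × Fin N → ℚ), ∀ e ∈ E,
        e ∈ T ↔ MvPolynomial.eval a (sUnitPolynomial S c e) = 0 := fun T hT ↦ by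
    obtain ⟨r, hr, hrT⟩ := h T hT
    obtain ⟨c, a, hca⟩ := exists_sUnitPolynomial hP hr
    exact ⟨c, a, fun e he ↦ (hrT e he).trans (hca e (hE e he))⟩
  have : Nonempty (Fin N → Fin N) := ⟨id⟩
  choose! c a hca using h'
  have key := Finset.card_le_mul_card_image_of_maps_to (f := c) (s := E.powerset)
    (t := Finset.univ) (fun _ _ ↦ Finset.mem_univ _)
    (((2 * S.card + 2) * E.card + 1) ^ (N + S.card * N)) fun d _ ↦ by
      have := MvPolynomial.card_zero_patterns_le (sUnitPolynomial S d) (2 * S.card + 2)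
        (degreeOf_sUnitPolynomial_le S d) E (E.powerset.filter fun T ↦ c T = d)
        (fun T hT ↦ Finset.mem_powerset.1 (Finset.mem_filter.1 hT).1) fun T hT ↦ by
          obtain ⟨hTE, rfl⟩ := Finset.mem_filter.1 hT
          exact ⟨a T, hca T (Finset.mem_powerset.1 hTE)⟩
      simpa using this
  simpa using key

lemma IsSUnit.neg {S : Finset ℕ} {u : ℚ} (h : IsSUnit S u) : IsSUnit S (-u) := by
  simpa [IsSUnit] using h

lemma isSUnit_sub_comm {S : Finset ℕ} {x y : ℚ} : IsSUnit S (x - y) ↔ IsSUnit S (y - x) :=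
  ⟨fun h ↦ by simpa using h.neg, fun h ↦ by simpa using h.neg⟩

lemma isSUnit_pow_mul_pow {S : Finset ℕ} (hP : ∀ p ∈ S, p.Prime) {p q : ℕ} (hp : p ∈ S)
    (hq : q ∈ S) (a b : ℕ) : IsSUnit S ((p : ℚ) ^ a * (q : ℚ) ^ b) := by
  have hp0 := (hP p hp).ne_zero
  have hq0 := (hP q hq).ne_zero
  refine ⟨by positivity, fun l hl hd ↦ ?_⟩
  have hcast : (p : ℚ) ^ a * (q : ℚ) ^ b = ((p ^ a * q ^ b : ℕ) : ℚ) := by push_cast; rfl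
  rw [hcast, Rat.num_natCast, Rat.den_natCast, Int.natCast_dvd_natCast, hl.dvd_mul] at hd
  rcases hd with (hd | hd) | hd
  · rwa [(Nat.prime_dvd_prime_iff_eq hl (hP p hp)).1 (hl.dvd_of_dvd_pow hd)]
  · rwa [(Nat.prime_dvd_prime_iff_eq hl (hP q hq)).1 (hl.dvd_of_dvd_pow hd)]
  · exact absurd (Nat.dvd_one.1 hd) hl.one_lt.ne'

lemma pow_mul_pow_inj {p q : ℕ} (hp : p.Prime) (hq : q.Prime) (hpq : p ≠ q) {a b a' b' : ℕ}
    (h : p ^ a * q ^ b = p ^ a' * q ^ b') : a = a' ∧ b = b' := by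
  have key : ∀ {p q : ℕ}, p.Prime → q.Prime → p ≠ q → ∀ a b : ℕ,
      (p ^ a * q ^ b).factorization p = a := fun hp hq hpq a b ↦ by
    rw [Nat.factorization_mul (pow_ne_zero _ hp.ne_zero) (pow_ne_zero _ hq.ne_zero),
      hp.factorization_pow, hq.factorization_pow]
    simp [hpq]
  refine ⟨?_, ?_⟩
  · rw [← key hp hq hpq a b, h, key hp hq hpq]
  · rw [← key hq hp hpq.symm b a, mul_comm, h, mul_comm, key hq hp hpq.symm]

open Classical in
/-- The edges of the `S`-unit graph on `{0, …, N - 1}`, as increasing pairs. -/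
noncomputable def sUnitEdges (S : Finset ℕ) (N : ℕ) : Finset (Fin N × Fin N) :=
  Finset.univ.filter fun e ↦ e.1 < e.2 ∧ IsSUnit S ((e.1 : ℚ) - (e.2 : ℚ))

lemma le_card_sUnitEdges {S : Finset ℕ} (hP : ∀ p ∈ S, p.Prime) {p q : ℕ} (hp : p ∈ S)
    (hq : q ∈ S) (hpq : p ≠ q) (k : ℕ) :
    (p * q) ^ k * k ^ 2 ≤ (sUnitEdges S (2 * (p * q) ^ k)).card := by
  classical
  have hp1 := (hP p hp).pos
  have hq1 := (hP q hq).pos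
  have hle : ∀ a b : Fin k, p ^ a.val * q ^ b.val ≤ (p * q) ^ k := fun a b ↦ by
    rw [mul_pow]
    exact Nat.mul_le_mul (Nat.pow_le_pow_right hp1 a.2.le) (Nat.pow_le_pow_right hq1 b.2.le)
  have hpos : ∀ a b : ℕ, 0 < p ^ a * q ^ b := fun a b ↦ by positivity
  let φ : Fin ((p * q) ^ k) × Fin k × Fin k →
      Fin (2 * (p * q) ^ k) × Fin (2 * (p * q) ^ k) := fun w ↦
    (⟨w.1, by omega⟩, ⟨w.1 + p ^ w.2.1.val * q ^ w.2.2.val, by have := hle w.2.1 w.2.2; omega⟩)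
  have hφ : Function.Injective φ := by
    rintro ⟨i, a, b⟩ ⟨i', a', b'⟩ h
    simp only [φ, Prod.mk.injEq, Fin.mk.injEq] at h
    obtain ⟨h1, h2⟩ := h
    obtain ⟨h3, h4⟩ := pow_mul_pow_inj (hP p hp) (hP q hq) hpq
      (show p ^ a.val * q ^ b.val = p ^ a'.val * q ^ b'.val by omega)
    simp [Fin.ext_iff, h1, h3, h4]
  calc (p * q) ^ k * k ^ 2 = (Finset.univ.image φ).card := by
        rw [Finset.card_image_of_injective _ hφ]
        simp [sq]
    _ ≤ _ := Finset.card_le_card fun e he ↦ by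
        obtain ⟨⟨i, a, b⟩, -, rfl⟩ := Finset.mem_image.1 he
        simp only [sUnitEdges, Finset.mem_filter, Finset.mem_univ, true_and, φ]
        refine ⟨Fin.mk_lt_mk.2 (Nat.lt_add_of_pos_right (hpos _ _)), ?_⟩
        push_cast
        rw [sub_add_cancel_left]
        exact (isSUnit_pow_mul_pow hP hp hq _ _).neg

/-- Every graph on `Fin N` that embeds in the `S`-unit graph is an induced subgraph of it. -/
def SubgraphsInduced (S : Finset ℕ) (N : ℕ) : Prop :=
  ∀ (G : SimpleGraph (Fin N)) (q : Fin N → ℚ), Function.Injective q →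
    (∀ i j : Fin N, G.Adj i j → IsSUnit S (q i - q j)) →
    ∃ r : Fin N → ℚ, Function.Injective r ∧
      ∀ i j : Fin N, i ≠ j → (G.Adj i j ↔ IsSUnit S (r i - r j))

lemma SubgraphsInduced.exists_of_pairs {S : Finset ℕ} {N : ℕ} (h : SubgraphsInduced S N)
    (T : Finset (Fin N × Fin N)) (q : Fin N → ℚ) (hq : Function.Injective q)
    (hT : ∀ e ∈ T, IsSUnit S (q e.1 - q e.2)) :
    ∃ r : Fin N → ℚ, Function.Injective r ∧
      ∀ i j : Fin N, IsSUnit S (r i - r j) ↔ (i, j) ∈ T ∨ (j, i) ∈ T := by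
  have hne : ∀ i, (i, i) ∉ T := fun i hi ↦ (hT _ hi).1 (sub_self _)
  let G : SimpleGraph (Fin N) :=
    { Adj := fun i j ↦ (i, j) ∈ T ∨ (j, i) ∈ T
      symm := ⟨fun _ _ ↦ Or.symm⟩
      loopless := ⟨fun i hi ↦ hne i (by simpa using hi)⟩ }
  obtain ⟨r, hr, hadj⟩ := h G q hq fun i j hij ↦ by
    rcases hij with hij | hij
    · exact hT _ hij
    · exact isSUnit_sub_comm.1 (hT _ hij)
  refine ⟨r, hr, fun i j ↦ ?_⟩
  rcases eq_or_ne i j with rfl | hij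
  · simp [hne, IsSUnit]
  · exact (hadj i j hij).symm

lemma SubgraphsInduced.two_pow_card_sUnitEdges_le {S : Finset ℕ} (hP : ∀ p ∈ S, p.Prime) {N : ℕ}
    (h : SubgraphsInduced S N) :
    2 ^ (sUnitEdges S N).card ≤ ((2 * S.card + 2) * (sUnitEdges S N).card + 1) ^
      (N + S.card * N) * (N ^ N * N ^ N) ^ S.card := by
  have hmem : ∀ e : Fin N × Fin N, e ∈ sUnitEdges S N ↔
      e.1 < e.2 ∧ IsSUnit S ((e.1 : ℚ) - (e.2 : ℚ)) := by simp [sUnitEdges]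
  refine two_pow_card_edges_le hP _ (fun e he ↦ ((hmem e).1 he).1.ne) fun T hT ↦ ?_
  obtain ⟨r, hr, hadj⟩ := h.exists_of_pairs T (fun i ↦ (i.val : ℚ))
    (Nat.cast_injective.comp Fin.val_injective) fun e he ↦ ((hmem e).1 (hT he)).2
  refine ⟨r, hr, fun e he ↦ ?_⟩
  rw [hadj]
  exact ⟨Or.inl, fun h ↦ h.resolve_right fun h' ↦
    ((hmem _).1 (hT h')).1.not_gt ((hmem e).1 he).1⟩

/-- The edges of the `S`-unit graph on an interval are too numerous for `two_pow_card_edges_le`. -/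
lemma exists_card_sUnitEdges_lt {S : Finset ℕ} (hP : ∀ p ∈ S, p.Prime) {p q : ℕ} (hp : p ∈ S)
    (hq : q ∈ S) (hpq : p ≠ q) :
    ∃ N : ℕ, ((2 * S.card + 2) * (sUnitEdges S N).card + 1) ^
      (N + S.card * N) * (N ^ N * N ^ N) ^ S.card < 2 ^ (sUnitEdges S N).card := by
  obtain ⟨s, hs⟩ : ∃ s, S.card = s := ⟨_, rfl⟩
  have hp1 := (hP p hp).pos
  have hq1 := (hP q hq).pos
  set Q := p * q with hQ
  have hQ2 : Q ≤ 2 ^ Q := Nat.lt_two_pow_self.le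
  let C := 12 * s ^ 2 + 40 * s + 20
  let k := (Q + 1) * C + 1
  refine ⟨2 * Q ^ k, ?_⟩
  set N := 2 * Q ^ k with hN
  have hE := le_card_sUnitEdges hP hp hq hpq k
  rw [hs]
  set m := (sUnitEdges S N).card with hm
  have hmN : m ≤ N * N := by simpa using Finset.card_le_univ (sUnitEdges S N)
  have hNle : N ≤ 2 ^ (k * (Q + 1)) := by
    calc N ≤ 2 * (2 ^ Q) ^ k := Nat.mul_le_mul_left _ (Nat.pow_le_pow_left hQ2 k)
      _ = 2 ^ (1 + Q * k) := by rw [← pow_mul, pow_add, pow_one]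
      _ ≤ 2 ^ (k * (Q + 1)) := by
        refine Nat.pow_le_pow_right two_pos ?_
        have : 1 ≤ k := Nat.le_add_left _ _
        nlinarith
  set L := k * (Q + 1) with hL
  have hL1 : 1 ≤ L := by
    rw [hL]
    exact Nat.mul_pos (Nat.succ_pos _) (Nat.succ_pos _)
  have hbase : (2 * s + 2) * m + 1 ≤ 2 ^ ((2 * s + 5) * L) := by
    have h1 : 2 * s + 3 ≤ 2 ^ (2 * s + 3) := Nat.lt_two_pow_self.le
    have hNpos : 0 < N * N := by positivity
    calc (2 * s + 2) * m + 1 ≤ (2 * s + 3) * (N * N) := by nlinarith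
      _ ≤ 2 ^ (2 * s + 3) * (2 ^ L * 2 ^ L) := Nat.mul_le_mul h1 (Nat.mul_le_mul hNle hNle)
      _ = 2 ^ (2 * s + 3 + (L + L)) := by rw [← pow_add, ← pow_add]
      _ ≤ 2 ^ ((2 * s + 5) * L) := Nat.pow_le_pow_right two_pos (by nlinarith)
  calc ((2 * s + 2) * m + 1) ^ (N + s * N) * (N ^ N * N ^ N) ^ s
      ≤ (2 ^ ((2 * s + 5) * L)) ^ (N + s * N) * ((2 ^ L) ^ N * (2 ^ L) ^ N) ^ s := by gcongr
    _ = 2 ^ (((2 * s + 5) * (1 + s) + 2 * s) * L * N) := by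
      rw [← pow_mul, ← pow_mul, ← pow_add, ← pow_mul, ← pow_add]
      ring_nf
    _ < 2 ^ m := by
      refine Nat.pow_lt_pow_right one_lt_two (lt_of_lt_of_le ?_ hE)
      have hQk : 0 < Q ^ k := by positivity
      have hk : (Q + 1) * C < k := Nat.lt_succ_self _
      have hC : 2 * ((2 * s + 5) * (1 + s) + 2 * s) ≤ C := by
        simp only [C]; nlinarith
      calc ((2 * s + 5) * (1 + s) + 2 * s) * L * N
          = Q ^ k * (k * ((Q + 1) * (2 * ((2 * s + 5) * (1 + s) + 2 * s)))) := by
            rw [hN, hL]; ring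
        _ ≤ Q ^ k * (k * ((Q + 1) * C)) := by gcongr
        _ < Q ^ k * (k * k) := by
            have : 0 < k := Nat.succ_pos _
            gcongr
        _ = Q ^ k * k ^ 2 := by rw [sq]

lemma IsSUnit.mul {S : Finset ℕ} {u v : ℚ} (hu : IsSUnit S u) (hv : IsSUnit S v) :
    IsSUnit S (u * v) := by
  rw [isSUnit_iff] at *
  refine ⟨mul_ne_zero hu.1 hv.1, fun p hp hpS ↦ ?_⟩
  have := Fact.mk hp
  rw [padicValRat.mul hu.1 hv.1, hu.2 p hp hpS, hv.2 p hp hpS, add_zero]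

lemma IsSUnit.inv {S : Finset ℕ} {u : ℚ} (hu : IsSUnit S u) : IsSUnit S u⁻¹ := by
  rw [isSUnit_iff] at *
  refine ⟨inv_ne_zero hu.1, fun p hp hpS ↦ ?_⟩
  have := Fact.mk hp
  rw [padicValRat.inv, hu.2 p hp hpS, neg_zero]

lemma isSUnit_pow {p : ℕ} (hp : p.Prime) (k : ℕ) : IsSUnit {p} ((p : ℚ) ^ k) := by
  have hP : ∀ q ∈ ({p} : Finset ℕ), q.Prime := by simpa using hp
  simpa using isSUnit_pow_mul_pow hP (Finset.mem_singleton_self p) (Finset.mem_singleton_self p) k 0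

lemma isSUnit_zpow {p : ℕ} (hp : p.Prime) (k : ℤ) : IsSUnit {p} ((p : ℚ) ^ k) := by
  obtain ⟨n, rfl | rfl⟩ := k.eq_nat_or_neg
  · simpa using isSUnit_pow hp n
  · simpa using (isSUnit_pow hp n).inv

lemma IsSUnit.eq_zpow {p : ℕ} (hp : p.Prime) {u : ℚ} (hu : IsSUnit {p} u) :
    u = (p : ℚ) ^ padicValRat p u ∨ u = -(p : ℚ) ^ padicValRat p u := by
  have hP : ∀ q ∈ ({p} : Finset ℕ), q.Prime := by simpa using hp
  simpa using (isSUnit_iff_eq_prod hP hu.1).1 hu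

lemma not_isSUnit_natCast_mul {p q : ℕ} (hq : q.Prime) (hqp : q ≠ p) {u : ℚ}
    (hu : IsSUnit {p} u) : ¬ IsSUnit {p} (q * u) := fun h ↦ by
  have h' := h.mul hu.inv
  rw [mul_assoc, mul_inv_cancel₀ hu.1, mul_one] at h'
  exact hqp (by simpa using h'.2 q hq (by simp))

/-- In a sum of two units for a single prime, a unit of smaller valuation is determined up to
sign. -/
lemma IsSUnit.eq_or_of_add {p : ℕ} (hp : p.Prime) {u v : ℚ} (hu : IsSUnit {p} u)
    (hv : IsSUnit {p} v) (huv : u + v ≠ 0) :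
    u = v ∨ (u = (p : ℚ) ^ padicValRat p (u + v) ∨ u = -(p : ℚ) ^ padicValRat p (u + v)) ∨
      (v = (p : ℚ) ^ padicValRat p (u + v) ∨ v = -(p : ℚ) ^ padicValRat p (u + v)) := by
  have := Fact.mk hp
  rcases lt_trichotomy (padicValRat p u) (padicValRat p v) with h | h | h
  · rw [padicValRat.add_eq_of_lt huv hu.1 hv.1 h]
    exact Or.inr (Or.inl (hu.eq_zpow hp))
  · left
    have h1 := hu.eq_zpow hp
    have h2 := hv.eq_zpow hp
    rw [h] at h1
    rcases h1 with h1 | h1 <;> rcases h2 with h2 | h2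
    · exact h1.trans h2.symm
    · exact absurd (by linarith) huv
    · exact absurd (by linarith) huv
    · exact h1.trans h2.symm
  · rw [add_comm u v, padicValRat.add_eq_of_lt (by rwa [add_comm]) hv.1 hu.1 h]
    exact Or.inr (Or.inr (hv.eq_zpow hp))

lemma padicValRat_two_mul {p : ℕ} (hp : p.Prime) (hp2 : p ≠ 2) {u : ℚ} (hu : u ≠ 0) :
    padicValRat p (2 * u) = padicValRat p u := by
  have := Fact.mk hp
  have : Fact (Nat.Prime 2) := ⟨Nat.prime_two⟩
  have h2 : padicValRat p (2 : ℚ) = 0 := by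
    simpa [padicValNat_primes hp2] using padicValRat.of_nat (p := p) (n := 2)
  rw [padicValRat.mul two_ne_zero hu, h2, zero_add]

lemma exists_sUnit_of_add {p : ℕ} (hp : p.Prime) (hp2 : p ≠ 2) {a : ℚ} (ha : a ≠ 0) :
    ∃ c, IsSUnit {p} c ∧ ∀ u, IsSUnit {p} u → IsSUnit {p} (a - u) →
      (u = c ∨ u = -c) ∨ (a - u = c ∨ a - u = -c) := by
  refine ⟨(p : ℚ) ^ padicValRat p a, isSUnit_zpow hp _, fun u hu hv ↦ ?_⟩
  have hau : u + (a - u) = a := add_sub_cancel _ _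
  have h := hu.eq_or_of_add hp hv (by rwa [hau])
  rw [hau] at h
  refine h.elim (fun h ↦ Or.inl ?_) id
  have hval : padicValRat p a = padicValRat p u := by
    rw [show a = 2 * u by linarith, padicValRat_two_mul hp hp2 hu.1]
  rw [hval]
  exact hu.eq_zpow hp

/-- For an odd prime, two common neighbours span a parallelogram, except for a configuration
special to the prime `3`. -/
lemma add_eq_or_of_sUnit_sub {p : ℕ} (hp : p.Prime) (hp2 : p ≠ 2) {a u v : ℚ} (ha : a ≠ 0)
    (huv : u ≠ v) (hu : IsSUnit {p} u) (hu' : IsSUnit {p} (a - u)) (hv : IsSUnit {p} v)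
    (hv' : IsSUnit {p} (a - v)) :
    u + v = a ∨ p = 3 ∧ ∃ d, IsSUnit {p} d ∧ a = 2 * d ∧
      ∀ w, IsSUnit {p} w → IsSUnit {p} (a - w) → w = d ∨ w = -d ∨ w = 3 * d := by
  obtain ⟨c, hc, hac⟩ := exists_sUnit_of_add hp hp2 ha
  by_cases hboth : IsSUnit {p} (a - c) ∧ IsSUnit {p} (a + c)
  · right
    have h2c : 2 * c ≠ 0 := mul_ne_zero two_ne_zero hc.1
    have h3 : ∀ {x}, x = 3 * c ∨ x = -(3 * c) → IsSUnit {p} x → p = 3 := fun {x} hx hxu ↦ by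
      by_contra hne
      refine not_isSUnit_natCast_mul Nat.prime_three (Ne.symm hne) hc ?_
      rcases hx with rfl | rfl
      · exact_mod_cast hxu
      · simpa using hxu.neg
    have hsum : a = 2 * c ∨ a = -(2 * c) := by
      have hbc : (a + c) + -(a - c) = 2 * c := by ring
      have h := hboth.2.eq_or_of_add hp hboth.1.neg (by rwa [hbc])
      have hval : (p : ℚ) ^ padicValRat p (2 * c) = c ∨ (p : ℚ) ^ padicValRat p (2 * c) = -c := by
        rw [padicValRat_two_mul hp hp2 hc.1]
        rcases hc.eq_zpow hp with h | h
        · exact Or.inl h.symm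
        · exact Or.inr (by linarith)
      rw [hbc] at h
      rcases hval with hval | hval <;> rw [hval] at h <;>
        rcases h with h | (h | h) | (h | h) <;>
        first
          | exact absurd (by linarith) ha
          | exact Or.inl (by linarith)
          | exact Or.inr (by linarith)
    rcases hsum with h | h
    · refine ⟨h3 (Or.inl (by linarith)) hboth.2, c, hc, h, fun w hw hw' ↦ ?_⟩
      rcases hac w hw hw' with (h' | h') | (h' | h')
      · exact Or.inl h'
      · exact Or.inr (Or.inl h')
      · exact Or.inl (by linarith)
      · exact Or.inr (Or.inr (by linarith))
    · refine ⟨h3 (Or.inr (by linarith)) hboth.1, -c, hc.neg, by linarith, fun w hw hw' ↦ ?_⟩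
      rcases hac w hw hw' with (h' | h') | (h' | h')
      · exact Or.inr (Or.inl (by linarith))
      · exact Or.inl h'
      · exact Or.inr (Or.inr (by linarith))
      · exact Or.inl (by linarith)
  · left
    have key : ∀ w, IsSUnit {p} w → IsSUnit {p} (a - w) →
        (IsSUnit {p} (a - c) ∧ (w = c ∨ w = a - c)) ∨
        (IsSUnit {p} (a + c) ∧ (w = -c ∨ w = a + c)) := fun w hw hw' ↦ by
      rcases hac w hw hw' with (h | h) | (h | h)
      · exact Or.inl ⟨h ▸ hw', Or.inl h⟩
      · refine Or.inr ⟨?_, Or.inl h⟩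
        rwa [h, sub_neg_eq_add] at hw'
      · have : w = a - c := by linarith
        exact Or.inl ⟨this ▸ hw, Or.inr this⟩
      · have : w = a + c := by linarith
        exact Or.inr ⟨this ▸ hw, Or.inr this⟩
    rcases key u hu hu' with ⟨h1, h | h⟩ | ⟨h1, h | h⟩ <;>
      rcases key v hv hv' with ⟨h2, h' | h'⟩ | ⟨h2, h' | h'⟩ <;>
      first
        | exact absurd (h.trans h'.symm) huv
        | exact (hboth ⟨h1, h2⟩).elim
        | exact (hboth ⟨h2, h1⟩).elim
        | linarith

lemma not_subgraphsInduced_of_one_lt_card {S : Finset ℕ} (hP : ∀ p ∈ S, p.Prime)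
    (hS : 1 < S.card) : ∃ N, ¬ SubgraphsInduced S N := by
  obtain ⟨p, hp, q, hq, hpq⟩ := Finset.one_lt_card.1 hS
  obtain ⟨N, hN⟩ := exists_card_sUnitEdges_lt hP hp hq hpq
  exact ⟨N, fun h ↦ (h.two_pow_card_sUnitEdges_le hP).not_gt hN⟩

/-- For the prime `2`, any four common neighbours of two vertices include an adjacent pair. -/
lemma exists_isSUnit_two_sub {a : ℚ} (ha : a ≠ 0) {P : Finset ℚ} (hcard : P.card = 4)
    (hP : ∀ u ∈ P, IsSUnit {2} u ∧ IsSUnit {2} (a - u)) :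
    ∃ u ∈ P, ∃ v ∈ P, IsSUnit {2} (u - v) := by
  obtain ⟨c, hc, hcP, hca⟩ : ∃ c, IsSUnit {2} c ∧
      (∀ u ∈ P, u = a / 2 ∨ u = c ∨ u = -c ∨ u = a - c ∨ u = a + c) ∧
      (IsSUnit {2} a → a = c ∨ a = -c) := by
    refine ⟨((2 : ℕ) : ℚ) ^ padicValRat 2 a, isSUnit_zpow Nat.prime_two _, fun u hu ↦ ?_,
      fun h ↦ h.eq_zpow Nat.prime_two⟩
    have hau : u + (a - u) = a := add_sub_cancel _ _
    have h := (hP u hu).1.eq_or_of_add Nat.prime_two (hP u hu).2 (by rwa [hau])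
    rw [hau] at h
    rcases h with h | (h | h) | (h | h)
    · exact Or.inl (by linarith)
    · exact Or.inr (Or.inl h)
    · exact Or.inr (Or.inr (Or.inl h))
    · exact Or.inr (Or.inr (Or.inr (Or.inl (by linarith))))
    · exact Or.inr (Or.inr (Or.inr (Or.inr (by linarith))))
  have h2 : IsSUnit {2} (2 : ℚ) := by simpa using isSUnit_pow Nat.prime_two 1
  by_cases hmid : a / 2 ∈ P
  · have haunit : IsSUnit {2} a := by
      have := h2.mul (hP _ hmid).1
      rwa [mul_div_cancel₀ _ two_ne_zero] at this
    have hsub : P ⊆ {a / 2, -a, 2 * a} := fun u hu ↦ by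
      have h0 := (hP u hu).1.1
      have h1 := (hP u hu).2.1
      have h1' : u ≠ a := fun h ↦ h1 (by rw [h, sub_self])
      simp only [Finset.mem_insert, Finset.mem_singleton]
      rcases hca haunit with h | h <;> rcases hcP u hu with h' | h' | h' | h' | h' <;>
        first
          | exact absurd (by linarith) h0
          | exact absurd (by linarith) h1'
          | exact Or.inl h'
          | exact Or.inr (Or.inl (by linarith))
          | exact Or.inr (Or.inr (by linarith))
    have := (Finset.card_le_card hsub).trans Finset.card_le_three
    omega
  · have hsub : P ⊆ {c, -c, a - c, a + c} := fun u hu ↦ by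
      simp only [Finset.mem_insert, Finset.mem_singleton]
      exact (hcP u hu).resolve_left fun h ↦ hmid (h ▸ hu)
    have heq := Finset.eq_of_subset_of_card_le hsub (by rw [hcard]; exact Finset.card_le_four)
    refine ⟨c, by simp [heq], -c, by simp [heq], ?_⟩
    rw [sub_neg_eq_add, ← two_mul]
    exact h2.mul hc

lemma not_subgraphsInduced_two : ¬ SubgraphsInduced {2} 6 := fun h ↦ by
  have h1 : IsSUnit {2} (1 : ℚ) := by simpa using isSUnit_pow Nat.prime_two 0
  have h2 : IsSUnit {2} (2 : ℚ) := by simpa using isSUnit_pow Nat.prime_two 1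
  have h4 : IsSUnit {2} (4 : ℚ) := by
    have := h2.mul h2
    norm_num at this
    exact this
  obtain ⟨r, hr, hadj⟩ := h.exists_of_pairs
    (Finset.univ.filter fun e : Fin 6 × Fin 6 ↦ e.1 < 2 ∧ 2 ≤ e.2) ![0, 3, -1, 1, 2, 4]
    (by
      intro i j hij
      fin_cases i <;> fin_cases j <;> first | rfl | (norm_num at hij))
    (by
      rintro ⟨i, j⟩ hij
      simp only [Finset.mem_filter, Finset.mem_univ, true_and] at hij
      obtain ⟨hi, hj⟩ := hij
      have hunit : ∀ x : ℚ, x ∈ ({1, -1, 2, -2, 4, -4} : Finset ℚ) → IsSUnit {2} x := by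
        intro x hx
        simp only [Finset.mem_insert, Finset.mem_singleton] at hx
        rcases hx with rfl | rfl | rfl | rfl | rfl | rfl
        exacts [h1, h1.neg, h2, h2.neg, h4, h4.neg]
      apply hunit
      fin_cases i <;> fin_cases j <;> first | (norm_num; done) | (exact absurd hi (by decide)) |
        (exact absurd hj (by decide)))
  simp only [Finset.mem_filter, Finset.mem_univ, true_and] at hadj
  have hinj : Function.Injective fun j : Fin 6 ↦ r j - r 0 := fun i j hij ↦ hr (by simpa using hij)
  obtain ⟨u, hu, v, hv, huv⟩ := exists_isSUnit_two_sub (a := r 1 - r 0)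
    (P := (Finset.univ.filter fun j : Fin 6 ↦ 2 ≤ j).image fun j ↦ r j - r 0)
    (sub_ne_zero.2 (hr.ne (by decide)))
    (by rw [Finset.card_image_of_injective _ hinj]; decide)
    (by
      intro u hu
      obtain ⟨j, hj, rfl⟩ := Finset.mem_image.1 hu
      have hj := (Finset.mem_filter.1 hj).2
      refine ⟨(hadj j 0).2 (Or.inr ⟨by decide, hj⟩), ?_⟩
      rw [sub_sub_sub_cancel_right]
      exact (hadj 1 j).2 (Or.inl ⟨by decide, hj⟩))
  obtain ⟨i, hi, rfl⟩ := Finset.mem_image.1 hu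
  obtain ⟨j, hj, rfl⟩ := Finset.mem_image.1 hv
  have hi := (Finset.mem_filter.1 hi).2
  have hj := (Finset.mem_filter.1 hj).2
  rw [sub_sub_sub_cancel_right, hadj] at huv
  omega

lemma exists_of_common_sUnit_neighbours_three {x y u v w : ℚ} (hxy : x ≠ y) (huv : u ≠ v)
    (huw : u ≠ w) (hvw : v ≠ w) (hxu : IsSUnit {3} (u - x)) (hyu : IsSUnit {3} (y - u))
    (hxv : IsSUnit {3} (v - x)) (hyv : IsSUnit {3} (y - v)) (hxw : IsSUnit {3} (w - x))
    (hyw : IsSUnit {3} (y - w)) :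
    ∃ d, IsSUnit {3} d ∧ y = x + 2 * d ∧ (u = x + d ∨ u = x - d ∨ u = x + 3 * d) ∧
      (v = x + d ∨ v = x - d ∨ v = x + 3 * d) ∧ (w = x + d ∨ w = x - d ∨ w = x + 3 * d) := by
  have ha : y - x ≠ 0 := sub_ne_zero.2 hxy.symm
  have hsub : ∀ t, IsSUnit {3} (y - t) → IsSUnit {3} ((y - x) - (t - x)) := fun t ht ↦ by
    rwa [sub_sub_sub_cancel_right]
  have h1 := add_eq_or_of_sUnit_sub Nat.prime_three (by norm_num) ha
    (sub_left_injective.ne huv) hxu (hsub u hyu) hxv (hsub v hyv)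
  have h2 := add_eq_or_of_sUnit_sub Nat.prime_three (by norm_num) ha
    (sub_left_injective.ne huw) hxu (hsub u hyu) hxw (hsub w hyw)
  obtain ⟨-, d, hd, had, hall⟩ : 3 = 3 ∧ ∃ d, IsSUnit {3} d ∧ y - x = 2 * d ∧
      ∀ w, IsSUnit {3} w → IsSUnit {3} (y - x - w) → w = d ∨ w = -d ∨ w = 3 * d := by
    rcases h1 with h1 | h1
    · rcases h2 with h2 | h2
      · exact absurd (by linarith) hvw
      · exact h2
    · exact h1
  have hall' : ∀ t, IsSUnit {3} (t - x) → IsSUnit {3} (y - t) →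
      t = x + d ∨ t = x - d ∨ t = x + 3 * d := fun t ht ht' ↦ by
    rcases hall _ ht (hsub t ht') with h | h | h
    · exact Or.inl (by linarith)
    · exact Or.inr (Or.inl (by linarith))
    · exact Or.inr (Or.inr (by linarith))
  exact ⟨d, hd, by linarith, hall' u hxu hyu, hall' v hxv hyv, hall' w hxw hyw⟩

/-- Sequences with unit differences at distances `1` and `3` are locally arithmetic progressions. -/
lemma sub_eq_sub_of_isSUnit_three {R : ℕ → ℚ} {n : ℕ}
    (hinj : ∀ i j, i < n → j < n → R i = R j → i = j)
    (h1 : ∀ i, i + 1 < n → IsSUnit {3} (R (i + 1) - R i))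
    (h3 : ∀ i, i + 3 < n → IsSUnit {3} (R (i + 3) - R i)) (m : ℕ) (hm : m + 6 < n) :
    R (m + 4) - R (m + 3) = R (m + 3) - R (m + 2) := by
  have hne : ∀ i j, i < n → j < n → i ≠ j → R i ≠ R j := fun i j hi hj hij h ↦
    hij (hinj i j hi hj h)
  have key : ∀ i, i + 4 < n → ∃ d, IsSUnit {3} d ∧ R (i + 3) = R (i + 1) + 2 * d ∧
      (R i = R (i + 1) + d ∨ R i = R (i + 1) - d ∨ R i = R (i + 1) + 3 * d) ∧
      (R (i + 2) = R (i + 1) + d ∨ R (i + 2) = R (i + 1) - d ∨ R (i + 2) = R (i + 1) + 3 * d) ∧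
      (R (i + 4) = R (i + 1) + d ∨ R (i + 4) = R (i + 1) - d ∨ R (i + 4) = R (i + 1) + 3 * d) :=
    fun i hi ↦ exists_of_common_sUnit_neighbours_three
      (hne _ _ (by omega) (by omega) (by omega)) (hne _ _ (by omega) (by omega) (by omega))
      (hne _ _ (by omega) (by omega) (by omega)) (hne _ _ (by omega) (by omega) (by omega))
      (isSUnit_sub_comm.1 (h1 i (by omega))) (h3 i (by omega)) (h1 (i + 1) (by omega))
      (h1 (i + 2) (by omega)) (h3 (i + 1) (by omega)) (isSUnit_sub_comm.1 (h1 (i + 3) (by omega)))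
  obtain ⟨d, hd, hd1, -⟩ := key m (by omega)
  obtain ⟨e, he, he1, h, h', h''⟩ := key (m + 1) (by omega)
  obtain ⟨f, hf, hf1, -⟩ := key (m + 2) (by omega)
  have h2 : ∀ x y : ℚ, IsSUnit {3} x → IsSUnit {3} y → (x = 2 * y ∨ x = -(2 * y)) → False :=
    fun x y hx hy hxy ↦ by
      refine not_isSUnit_natCast_mul Nat.prime_two (by norm_num) hy ?_
      rcases hxy with rfl | rfl
      · exact_mod_cast hx
      · simpa using hx.neg
  have n1 := hne (m + 1) (m + 3) (by omega) (by omega) (by omega)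
  have n2 := hne (m + 1) (m + 5) (by omega) (by omega) (by omega)
  have n3 := hne (m + 3) (m + 5) (by omega) (by omega) (by omega)
  have hd2 := h2 d e hd he
  have hf2 := h2 f e hf he
  rcases h' with h' | h' | h'
  · simp only [Nat.add_assoc, Nat.reduceAdd] at *
    linarith
  all_goals
    exfalso
    simp only [Nat.add_assoc, Nat.reduceAdd] at *
    rcases h with h | h | h <;> rcases h'' with h'' | h'' | h'' <;>
      first
        | exact n1 (by linarith)
        | exact n2 (by linarith)
        | exact n3 (by linarith)
        | exact hd2 (Or.inl (by linarith))
        | exact hd2 (Or.inr (by linarith))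
        | exact hf2 (Or.inl (by linarith))
        | exact hf2 (Or.inr (by linarith))

lemma not_subgraphsInduced_three : ¬ SubgraphsInduced {3} 14 := fun h ↦ by
  have h3 : IsSUnit {3} (3 : ℚ) := by simpa using isSUnit_pow Nat.prime_three 1
  obtain ⟨r, hr, hadj⟩ := h.exists_of_pairs
    (Finset.univ.filter fun e : Fin 14 × Fin 14 ↦ e.1.val = e.2.val + 1 ∨ e.1.val = e.2.val + 3)
    (fun i ↦ (i.val : ℚ)) (Nat.cast_injective.comp Fin.val_injective) (by
      intro e he
      rcases (Finset.mem_filter.1 he).2 with h | h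
      · simpa [h] using isSUnit_pow Nat.prime_three 0
      · simpa [h] using h3)
  simp only [Finset.mem_filter, Finset.mem_univ, true_and] at hadj
  let R : ℕ → ℚ := fun n ↦ r (Fin.ofNat 14 n)
  have hval : ∀ n < 14, (Fin.ofNat 14 n).val = n := fun n hn ↦ Nat.mod_eq_of_lt hn
  have h1' : ∀ i, i + 1 < 14 → IsSUnit {3} (R (i + 1) - R i) := fun i hi ↦
    (hadj _ _).2 (Or.inl (Or.inl (by rw [hval _ hi, hval i (by omega)])))
  have hstep := sub_eq_sub_of_isSUnit_three (R := R) (n := 14)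
    (fun i j hi hj hij ↦ by
      rw [← hval i hi, ← hval j hj, hr hij])
    h1' (fun i hi ↦ (hadj _ _).2 (Or.inl (Or.inr (by rw [hval _ hi, hval i (by omega)]))))
  have hlong : R 11 - R 2 = 3 * (3 * (R 3 - R 2)) := by
    have e0 := hstep 0 (by norm_num)
    have e1 := hstep 1 (by norm_num)
    have e2 := hstep 2 (by norm_num)
    have e3 := hstep 3 (by norm_num)
    have e4 := hstep 4 (by norm_num)
    have e5 := hstep 5 (by norm_num)
    have e6 := hstep 6 (by norm_num)
    have e7 := hstep 7 (by norm_num)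
    norm_num only at e0 e1 e2 e3 e4 e5 e6 e7
    linarith
  have hunit : IsSUnit {3} (R 11 - R 2) := by
    rw [hlong]
    exact h3.mul (h3.mul (h1' 2 (by norm_num)))
  have := (hadj _ _).1 hunit
  rw [hval 11 (by norm_num), hval 2 (by norm_num)] at this
  omega

/-- The edges of the three-dimensional cube except for one. -/
def cubeEdgesButOne : Finset (Fin 8 × Fin 8) :=
  {(1, 0), (3, 2), (5, 4), (2, 0), (3, 1), (6, 4), (7, 5), (4, 0), (5, 1), (6, 2), (7, 3)}

lemma not_subgraphsInduced_of_five_le {p : ℕ} (hp : p.Prime) (hp5 : 5 ≤ p) :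
    ¬ SubgraphsInduced {p} 8 := fun h ↦ by
  have hpQ : (5 : ℚ) ≤ p := by exact_mod_cast hp5
  have hpp : (5 : ℚ) * p ≤ p ^ 2 := by nlinarith
  have h1 : IsSUnit {p} (1 : ℚ) := by simpa using isSUnit_pow hp 0
  have hp1 : IsSUnit {p} (p : ℚ) := by simpa using isSUnit_pow hp 1
  have hp2 := isSUnit_pow hp 2
  obtain ⟨P, hP⟩ : ∃ P : ℚ, P = (p : ℚ) ^ 2 := ⟨_, rfl⟩
  rw [← hP] at hpp hp2
  obtain ⟨r, hr, hadj⟩ := h.exists_of_pairs cubeEdgesButOne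
    ![0, 1, (p : ℚ), p + 1, P, P + 1, P + p, P + p + 1]
    (Fin.strictMono_iff_lt_succ.2 fun i ↦ by
      fin_cases i <;> norm_num [Fin.succ] <;> linarith).injective
    (by
      intro e he
      have hunit : ∀ x : ℚ, x = 1 ∨ x = p ∨ x = P → IsSUnit {p} x := by
        rintro x (rfl | rfl | rfl)
        exacts [h1, hp1, hp2]
      apply hunit
      simp only [cubeEdgesButOne, Finset.mem_insert, Finset.mem_singleton] at he
      rcases he with rfl | rfl | rfl | rfl | rfl | rfl | rfl | rfl | rfl | rfl | rfl <;>
        first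
          | (left; simp; done)
          | (right; left; simp; done)
          | (right; right; simp))
  have hedge : ∀ e ∈ cubeEdgesButOne, IsSUnit {p} (r e.1 - r e.2) := fun e he ↦
    (hadj _ _).2 (Or.inl he)
  have hpar : ∀ x y z w : Fin 8, x ≠ w → y ≠ z → (y, x) ∈ cubeEdgesButOne →
      (z, x) ∈ cubeEdgesButOne → (w, y) ∈ cubeEdgesButOne → (w, z) ∈ cubeEdgesButOne →
      r y + r z = r x + r w := fun x y z w hxw hyz hyx hzx hwy hwz ↦ by
    have := add_eq_or_of_sUnit_sub hp (by omega) (a := r w - r x) (u := r y - r x)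
      (v := r z - r x) (sub_ne_zero.2 (hr.ne hxw.symm)) (sub_left_injective.ne (hr.ne hyz))
      (hedge _ hyx) (by rw [sub_sub_sub_cancel_right]; exact hedge _ hwy)
      (hedge _ hzx) (by rw [sub_sub_sub_cancel_right]; exact hedge _ hwz)
    rcases this with h | ⟨h, -⟩
    · linarith
    · omega
  have f1 := hpar 0 1 2 3 (by decide) (by decide) (by decide) (by decide) (by decide) (by decide)
  have f2 := hpar 0 1 4 5 (by decide) (by decide) (by decide) (by decide) (by decide) (by decide)
  have f3 := hpar 0 2 4 6 (by decide) (by decide) (by decide) (by decide) (by decide) (by decide)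
  have f4 := hpar 1 3 5 7 (by decide) (by decide) (by decide) (by decide) (by decide) (by decide)
  have hunit : IsSUnit {p} (r 7 - r 6) := by
    rw [show r 7 - r 6 = r 1 - r 0 by linarith]
    exact hedge (1, 0) (by decide)
  exact absurd ((hadj 7 6).1 hunit) (by decide)

lemma exists_not_subgraphsInduced {S : Finset ℕ} (hS : S.Nonempty) (hP : ∀ p ∈ S, p.Prime) :
    ∃ N, ¬ SubgraphsInduced S N := by
  by_cases hcard : 1 < S.card
  · exact not_subgraphsInduced_of_one_lt_card hP hcard
  · obtain ⟨p, rfl⟩ := Finset.card_eq_one.1 (le_antisymm (not_lt.1 hcard) hS.card_pos)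
    have hp : p.Prime := hP p (Finset.mem_singleton_self p)
    rcases eq_or_ne p 2 with rfl | hp2
    · exact ⟨6, not_subgraphsInduced_two⟩
    rcases eq_or_ne p 3 with rfl | hp3
    · exact ⟨14, not_subgraphsInduced_three⟩
    exact ⟨8, not_subgraphsInduced_of_five_le hp (hp.five_le_of_ne_two_of_ne_three hp2 hp3)⟩

theorem stmt_3 (S : Finset ℕ) (hS : S.Nonempty) (hP : ∀ p ∈ S, p.Prime) :
    ∃ (N : ℕ) (G : SimpleGraph (Fin N)) (q : Fin N → ℚ),
      Function.Injective q ∧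
      (∀ i j : Fin N, G.Adj i j → IsSUnit S (q i - q j)) ∧
      ¬ ∃ r : Fin N → ℚ, Function.Injective r ∧
        ∀ i j : Fin N, i ≠ j → (G.Adj i j ↔ IsSUnit S (r i - r j)) := by
  obtain ⟨N, hN⟩ := exists_not_subgraphsInduced hS hP
  simp only [SubgraphsInduced, not_forall] at hN
  obtain ⟨G, q, hq, hadj, hr⟩ := hN
  exact ⟨N, G, q, hq, hadj, hr⟩
end

section
/- Let S be a finite nonempty set of primes and let a and b be nonzero rational numbers. Then the number of pairs (x, y) of S-units satisfying ax + by = 1 is at most 3 · 7^{2·#S + 3}. -/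
/-- The form of degree `c` occurring in the Padé-type relation between powers of three
numbers with sum zero. -/
def padeForm {R : Type*} [CommRing R] (a b c : ℕ) (X Z : R) : R :=
  (-1) ^ b * ∑ j ∈ Finset.range (c + 1),
    (((a + j).choose j * (a + b + c + 1).choose (c - j) : ℕ) : R) * (X ^ j * Z ^ (c - j))

lemma integral_pow_mul_sub_one_pow (a b : ℕ) :
    ∫ s in (0 : ℝ)..1, s ^ a * (s - 1) ^ b =
      (-1) ^ b * ((a.factorial * b.factorial : ℕ) : ℝ) / ((a + b + 1).factorial : ℝ) := by
  induction b generalizing a with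
  | zero =>
    simp [Nat.factorial_succ]
    field_simp
  | succ b ih =>
    have h := intervalIntegral.integral_mul_deriv_eq_deriv_mul (a := (0 : ℝ)) (b := 1)
      (u := fun s : ℝ => (s - 1) ^ (b + 1)) (u' := fun s => (b + 1) * (s - 1) ^ b)
      (v := fun s : ℝ => s ^ (a + 1) / (a + 1)) (v' := fun s => s ^ a)
      (fun s _ => by
        have h1 := ((hasDerivAt_id' s).sub_const 1).fun_pow (b + 1)
        simpa using h1)
      (fun s _ => by
        have h1 := (hasDerivAt_pow (a + 1) s).div_const ((a : ℝ) + 1)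
        have : ((a : ℝ) + 1) ≠ 0 := by positivity
        convert h1 using 1
        push_cast
        field_simp)
      (by apply Continuous.intervalIntegrable; fun_prop)
      (by apply Continuous.intervalIntegrable; fun_prop)
    have e1 : ∫ s in (0 : ℝ)..1, s ^ a * (s - 1) ^ (b + 1) =
        ∫ s in (0 : ℝ)..1, (s - 1) ^ (b + 1) * s ^ a := by
      congr 1; ext s; ring
    have e2 : ∫ s in (0 : ℝ)..1, (b + 1) * (s - 1) ^ b * (s ^ (a + 1) / (a + 1)) =
        ((b : ℝ) + 1) / (a + 1) * ∫ s in (0 : ℝ)..1, s ^ (a + 1) * (s - 1) ^ b := by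
      rw [← intervalIntegral.integral_const_mul]
      congr 1; ext s; ring
    rw [e1, h, e2, ih]
    have ea : ((a : ℝ) + 1) ≠ 0 := by positivity
    rw [show a + 1 + b + 1 = a + (b + 1) + 1 by ring, Nat.factorial_succ a, Nat.factorial_succ b]
    push_cast
    simp
    field_simp
    ring_nf

lemma integral_three_pow (a b c : ℕ) (p q r : ℝ) :
    (((a + b + c + 1).factorial : ℝ) / ((a.factorial * b.factorial * c.factorial : ℕ) : ℝ)) *
      ∫ t in p..q, (t - p) ^ a * (t - q) ^ b * (t - r) ^ c =
    (q - p) ^ (a + b + 1) * padeForm a b c (q - p) (p - r) := by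
  have h := intervalIntegral.mul_integral_comp_mul_add (a := 0) (b := 1)
    (f := fun t : ℝ => (t - p) ^ a * (t - q) ^ b * (t - r) ^ c) (q - p) p
  simp only [mul_zero, zero_add, mul_one, sub_add_cancel] at h
  rw [← h]
  have e : ∀ s : ℝ, ((q - p) * s + p - p) ^ a * ((q - p) * s + p - q) ^ b *
      ((q - p) * s + p - r) ^ c = ∑ j ∈ Finset.range (c + 1),
        ((q - p) ^ (a + b) * ((q - p) ^ j * (p - r) ^ (c - j) * (c.choose j : ℝ))) *
          (s ^ (a + j) * (s - 1) ^ b) := by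
    intro s
    rw [show (q - p) * s + p - p = (q - p) * s by ring,
      show (q - p) * s + p - q = (q - p) * (s - 1) by ring,
      show (q - p) * s + p - r = (q - p) * s + (p - r) by ring, add_pow ((q - p) * s),
      Finset.mul_sum]
    refine Finset.sum_congr rfl fun j _ => ?_
    simp only [mul_pow, pow_add]
    ring
  simp only [e]
  rw [intervalIntegral.integral_finsetSum
    (fun j _ => by apply Continuous.intervalIntegrable; fun_prop)]
  simp only [intervalIntegral.integral_const_mul, integral_pow_mul_sub_one_pow, padeForm,
    Finset.mul_sum]
  refine Finset.sum_congr rfl fun j hj => ?_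
  obtain ⟨i, rfl⟩ : ∃ i, c = j + i := Nat.exists_eq_add_of_le (by simpa [Nat.lt_succ_iff] using hj)
  rw [show j + i - j = i by omega, show a + b + (j + i) + 1 = (a + j + b + 1) + i by ring,
    Nat.choose_symm_add.symm, Nat.choose_symm_add.symm]
  push_cast
  rw [Nat.cast_add_choose, Nat.cast_add_choose, Nat.cast_add_choose]
  have := fun n : ℕ => (Nat.cast_ne_zero (R := ℝ)).mpr n.factorial_ne_zero
  field_simp [this]
  ring

lemma padeForm_relation_real (a b c : ℕ) (X Y Z : ℝ) (h : X + Y + Z = 0) :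
    X ^ (a + b + 1) * padeForm a b c X Z + Y ^ (b + c + 1) * padeForm b c a Y X +
      Z ^ (c + a + 1) * padeForm c a b Z Y = 0 := by
  have h1 := integral_three_pow a b c 0 X (-Z)
  have h2 := integral_three_pow b c a X (-Z) 0
  have h3 := integral_three_pow c a b (-Z) 0 X
  rw [show X - 0 = X by ring, show 0 - -Z = Z by ring] at h1
  rw [show -Z - X = Y by linarith, show X - 0 = X by ring] at h2
  rw [show (0 : ℝ) - -Z = Z by ring, show -Z - X = Y by linarith] at h3
  rw [← h1, ← h2, ← h3]
  rw [show b + c + a + 1 = a + b + c + 1 by ring, show c + a + b + 1 = a + b + c + 1 by ring,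
    show b.factorial * c.factorial * a.factorial = a.factorial * b.factorial * c.factorial by ring,
    show c.factorial * a.factorial * b.factorial = a.factorial * b.factorial * c.factorial by ring,
    ← mul_add, ← mul_add]
  have e2 : ∀ t : ℝ, (t - X) ^ b * (t - -Z) ^ c * (t - 0) ^ a =
      (t - 0) ^ a * (t - X) ^ b * (t - -Z) ^ c := fun t => by ring
  have e3 : ∀ t : ℝ, (t - -Z) ^ c * (t - 0) ^ a * (t - X) ^ b =
      (t - 0) ^ a * (t - X) ^ b * (t - -Z) ^ c := fun t => by ring
  simp only [e2, e3]
  have hi : ∀ p q : ℝ, IntervalIntegrable (fun t : ℝ => (t - 0) ^ a * (t - X) ^ b * (t - -Z) ^ c)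
      MeasureTheory.volume p q := fun p q => by
    apply Continuous.intervalIntegrable; fun_prop
  rw [intervalIntegral.integral_add_adjacent_intervals (hi _ _) (hi _ _),
    intervalIntegral.integral_add_adjacent_intervals (hi _ _) (hi _ _)]
  simp

lemma map_padeForm {R R' : Type*} [CommRing R] [CommRing R'] (f : R →+* R') (a b c : ℕ) (X Z : R) :
    f (padeForm a b c X Z) = padeForm a b c (f X) (f Z) := by
  simp [padeForm]

lemma padeForm_smul {R : Type*} [CommRing R] (a b c : ℕ) (s X Z : R) :
    padeForm a b c (s * X) (s * Z) = s ^ c * padeForm a b c X Z := by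
  simp only [padeForm, Finset.mul_sum]
  refine Finset.sum_congr rfl fun j hj => ?_
  obtain ⟨i, rfl⟩ : ∃ i, c = j + i :=
    Nat.exists_eq_add_of_le (by simpa [Nat.lt_succ_iff] using hj)
  rw [Nat.add_sub_cancel_left]
  ring

lemma padeForm_zero_left {R : Type*} [CommRing R] (a b c : ℕ) (Z : R) :
    padeForm a b c 0 Z = (-1) ^ b * ((a + b + c + 1).choose c * Z ^ c) := by
  rw [padeForm, Finset.sum_range_succ']
  simp

lemma padeForm_zero_right {R : Type*} [CommRing R] (a b c : ℕ) (X : R) :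
    padeForm a b c X 0 = (-1) ^ b * ((a + c).choose c * X ^ c) := by
  rw [padeForm, Finset.sum_range_succ, Finset.sum_eq_zero]
  · simp
  · intro j hj
    have : c - j ≠ 0 := by have := Finset.mem_range.mp hj; omega
    simp [this]

lemma natDegree_padeForm_le (a b c : ℕ) {X Z : Polynomial ℝ} (hX : X.natDegree ≤ 1)
    (hZ : Z.natDegree ≤ 1) : (padeForm a b c X Z).natDegree ≤ c := by
  have h1 : ((-1 : Polynomial ℝ) ^ b).natDegree = 0 := by
    rcases neg_one_pow_eq_or (Polynomial ℝ) b with h | h <;> simp [h]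
  refine (Polynomial.natDegree_mul_le).trans ?_
  rw [h1, zero_add]
  refine Polynomial.natDegree_sum_le_of_forall_le _ _ fun j hj => ?_
  have hj : j ≤ c := by simpa [Nat.lt_succ_iff] using hj
  refine (Polynomial.natDegree_mul_le).trans ?_
  rw [Polynomial.natDegree_natCast, zero_add]
  refine (Polynomial.natDegree_mul_le).trans ?_
  have := Polynomial.natDegree_pow_le_of_le j hX
  have := Polynomial.natDegree_pow_le_of_le (c - j) hZ
  omega

lemma abs_padeForm_le (a b c : ℕ) (X Z H : ℤ) (hX : |X| ≤ H) (hZ : |Z| ≤ H) :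
    |padeForm a b c X Z| ≤ 2 ^ (a + c) * 2 ^ (a + b + c + 1) * H ^ c := by
  have hH : 0 ≤ H := (abs_nonneg X).trans hX
  rw [padeForm, abs_mul, abs_pow, abs_neg, abs_one, one_pow, one_mul]
  calc |∑ j ∈ Finset.range (c + 1), (((a + j).choose j * (a + b + c + 1).choose (c - j) : ℕ) : ℤ) *
        (X ^ j * Z ^ (c - j))|
      ≤ ∑ j ∈ Finset.range (c + 1),
          2 ^ (a + c) * ((a + b + c + 1).choose (c - j) : ℤ) * H ^ c := by
        refine (Finset.abs_sum_le_sum_abs _ _).trans (Finset.sum_le_sum fun j hj => ?_)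
        have hj : j ≤ c := by simpa [Nat.lt_succ_iff] using hj
        rw [abs_mul, abs_mul, abs_pow, abs_pow, Nat.abs_cast]
        have h1 : ((a + j).choose j : ℤ) ≤ 2 ^ (a + c) := by
          have := (Nat.choose_le_two_pow (a + j) j).trans
            (Nat.pow_le_pow_right (n := 2) (by norm_num) (by omega : a + j ≤ a + c))
          exact_mod_cast this
        have h2 : |X| ^ j * |Z| ^ (c - j) ≤ H ^ c := by
          calc |X| ^ j * |Z| ^ (c - j) ≤ H ^ j * H ^ (c - j) := by gcongr
            _ = H ^ c := by rw [← pow_add]; congr 1; omega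
        push_cast
        gcongr
    _ = 2 ^ (a + c) * (∑ j ∈ Finset.range (c + 1), ((a + b + c + 1).choose j : ℤ)) * H ^ c := by
        rw [← Finset.sum_range_reflect, Finset.mul_sum, Finset.sum_mul]
        refine Finset.sum_congr rfl fun j hj => ?_
        have hj : j ≤ c := by simpa [Nat.lt_succ_iff] using hj
        congr 4
        omega
    _ ≤ 2 ^ (a + c) * 2 ^ (a + b + c + 1) * H ^ c := by
        have : (∑ j ∈ Finset.range (c + 1), ((a + b + c + 1).choose j : ℤ)) ≤
            2 ^ (a + b + c + 1) := by
          have h := Nat.sum_range_choose (a + b + c + 1)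
          have h' : ∑ j ∈ Finset.range (c + 1), (a + b + c + 1).choose j ≤ 2 ^ (a + b + c + 1) := by
            rw [← h]
            exact Finset.sum_le_sum_of_subset (Finset.range_mono (by omega))
          exact_mod_cast h'
        gcongr

/-- Up to a factor, the second minor of the two Padé relations of exponent `2 * n + 2`. -/
def padeMinor {R : Type*} [CommRing R] (n : ℕ) (X Y Z : R) : R :=
  padeForm n n (n + 1) Y X * padeForm n n (n + 1) Z Y -
    Z * padeForm (n + 1) n n Y X * (Y * padeForm n (n + 1) n Z Y)

lemma pade_relation_fst (n : ℕ) (X Y Z : ℝ) (h : X + Y + Z = 0) :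
    X ^ (2 * n + 2) * (Y * padeForm (n + 1) n n X Z) +
      Y ^ (2 * n + 2) * padeForm n n (n + 1) Y X +
      Z ^ (2 * n + 2) * (Y * padeForm n (n + 1) n Z Y) = 0 := by
  have := padeForm_relation_real (n + 1) n n X Y Z h
  rw [show n + 1 + n + 1 = 2 * n + 2 by ring, show n + n + 1 = 2 * n + 1 by ring,
    show n + (n + 1) + 1 = 2 * n + 2 by ring] at this
  linear_combination Y * this

lemma pade_relation_snd (n : ℕ) (X Y Z : ℝ) (h : X + Y + Z = 0) :
    X ^ (2 * n + 2) * (Z * padeForm n (n + 1) n X Z) +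
      Y ^ (2 * n + 2) * (Z * padeForm (n + 1) n n Y X) +
      Z ^ (2 * n + 2) * padeForm n n (n + 1) Z Y = 0 := by
  have := padeForm_relation_real n (n + 1) n X Y Z h
  rw [show n + 1 + n + 1 = 2 * n + 2 by ring, show n + n + 1 = 2 * n + 1 by ring,
    show n + (n + 1) + 1 = 2 * n + 2 by ring] at this
  linear_combination Z * this

open Polynomial in
lemma exists_padeMinor_eq (n : ℕ) : ∃ l : ℝ, l ≠ 0 ∧ ∀ z : ℝ,
    padeMinor n z (-1 - z) 1 = l * z ^ (2 * n + 2) := by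
  have hev : ∀ (z : ℝ) (a b c : ℕ) (P Q : ℝ[X]),
      (padeForm a b c P Q).eval z = padeForm a b c (P.eval z) (Q.eval z) := fun z a b c P Q => by
    simpa using map_padeForm (evalRingHom z) a b c P Q
  have hdY : (-1 - X : ℝ[X]).natDegree ≤ 1 := by compute_degree
  have hdX : (X : ℝ[X]).natDegree ≤ 1 := by compute_degree
  have hd1 : (1 : ℝ[X]).natDegree ≤ 1 := by simp
  set W : ℝ[X] := padeMinor n X (-1 - X) 1 with hW
  have hWe : ∀ z, W.eval z = padeMinor n z (-1 - z) 1 := fun z => by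
    simp [hW, padeMinor, hev]
  have hdvd : (X : ℝ[X]) ^ (2 * n + 2) ∣ W := by
    have hc : IsCoprime ((X : ℝ[X]) ^ (2 * n + 2)) ((-1 - X) ^ (2 * n + 2)) :=
      IsCoprime.pow ⟨-1, -1, by ring⟩
    refine hc.dvd_of_dvd_mul_left ⟨-(-1 - X) ^ (0 : ℕ) *
      ((-1 - X) * padeForm (n + 1) n n X 1 * padeForm n n (n + 1) 1 (-1 - X) -
        1 * padeForm n (n + 1) n X 1 * ((-1 - X) * padeForm n (n + 1) n 1 (-1 - X))), ?_⟩
    refine Polynomial.funext fun z => ?_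
    have h1 := pade_relation_fst n z (-1 - z) 1 (by ring)
    have h2 := pade_relation_snd n z (-1 - z) 1 (by ring)
    simp only [hW, padeMinor, eval_mul, eval_sub, eval_pow, eval_neg, eval_one, eval_X, hev]
    linear_combination (padeForm n n (n + 1) 1 (-1 - z)) * h1 -
      ((-1 - z) * padeForm n (n + 1) n 1 (-1 - z)) * h2
  obtain ⟨V, hV⟩ := hdvd
  have hdeg : W.natDegree ≤ 2 * n + 2 := by
    have a1 := natDegree_padeForm_le n n (n + 1) hdY hdX
    have a2 := natDegree_padeForm_le n n (n + 1) hd1 hdY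
    have a3 := natDegree_padeForm_le (n + 1) n n hdY hdX
    have a4 := natDegree_padeForm_le n (n + 1) n hd1 hdY
    refine (natDegree_sub_le_of_le (m := 2 * n + 2) (n := 2 * n + 2) ?_ ?_).trans (by simp)
    · exact natDegree_mul_le.trans (by omega)
    · rw [one_mul]
      refine natDegree_mul_le.trans ?_
      have := (natDegree_mul_le (p := (-1 - X : ℝ[X])) (q := padeForm n (n + 1) n 1 (-1 - X)))
      omega
  have hWne : W.eval (-1) ≠ 0 := by
    rw [hWe, padeMinor]
    norm_num [padeForm_zero_left, padeForm_zero_right]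
    exact ⟨(Nat.choose_pos (by omega)).ne', (Nat.choose_pos (by omega)).ne'⟩
  have hV0 : V ≠ 0 := by
    rintro rfl
    simp [hV] at hWne
  have hVdeg : V.natDegree = 0 := by
    rw [hV, natDegree_mul (by simp) hV0, natDegree_X_pow] at hdeg
    omega
  obtain ⟨l, rfl⟩ := natDegree_eq_zero.mp hVdeg
  refine ⟨l, by simpa using hV0, fun z => ?_⟩
  rw [← hWe, hV, eval_mul, eval_pow, eval_X, eval_C, mul_comm]

lemma padeMinor_ne_zero (n : ℕ) {X Y Z : ℝ} (h : X + Y + Z = 0) (hX : X ≠ 0) (hZ : Z ≠ 0) :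
    padeMinor n X Y Z ≠ 0 := by
  obtain ⟨l, hl, hm⟩ := exists_padeMinor_eq n
  have h1 := hm (X / Z)
  have hY : Y = Z * (-1 - X / Z) := by field_simp; linarith
  have hX' : X = Z * (X / Z) := by field_simp
  have : padeMinor n X Y Z = Z ^ (2 * n + 2) * padeMinor n (X / Z) (-1 - X / Z) 1 := by
    generalize hx : X / Z = x at *
    generalize hy : -1 - x = y at *
    rw [hX', hY]
    have h1 := fun a b c => padeForm_smul a b c Z y x
    have h2 := fun a b c => padeForm_smul a b c Z 1 y
    simp only [mul_one] at h2
    simp only [padeMinor, h1, h2]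
    ring
  rw [this, h1]
  positivity

/-- For integers with sum zero, the Padé relations of exponent `2 * n + 2` provide a relation
between the powers that is not proportional to a given one. -/
lemma exists_pade_relation (n : ℕ) {X Y Z H : ℤ} (h : X + Y + Z = 0) (hX : X ≠ 0)
    (hZ : Z ≠ 0) (hXH : |X| ≤ H) (hYH : |Y| ≤ H) (hZH : |Z| ≤ H) {y z : ℤ} (hy : y ≠ 0) :
    ∃ α β γ : ℤ, |α| ≤ 2 ^ (5 * n + 3) * H ^ (n + 1) ∧ |β| ≤ 2 ^ (5 * n + 3) * H ^ (n + 1) ∧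
      |γ| ≤ 2 ^ (5 * n + 3) * H ^ (n + 1) ∧
      X ^ (2 * n + 2) * α + Y ^ (2 * n + 2) * β + Z ^ (2 * n + 2) * γ = 0 ∧
      y * (Z ^ (2 * n + 2) * γ) - z * (Y ^ (2 * n + 2) * β) ≠ 0 := by
  have hH : 0 ≤ H := (abs_nonneg X).trans hXH
  have hcast : ∀ (a b c : ℕ) (P Q : ℤ), ((padeForm a b c P Q : ℤ) : ℝ) = padeForm a b c (P : ℝ) Q :=
    fun a b c P Q => map_padeForm (Int.castRingHom ℝ) a b c P Q
  have hs : (X : ℝ) + Y + Z = 0 := by exact_mod_cast h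
  have r1 := pade_relation_fst n (X : ℝ) Y Z hs
  have r2 := pade_relation_snd n (X : ℝ) Y Z hs
  have hm := padeMinor_ne_zero n hs (by exact_mod_cast hX) (by exact_mod_cast hZ)
  simp only [padeMinor, ← hcast] at r1 r2 hm
  norm_cast at r1 r2 hm
  have b1 : ∀ P Q : ℤ, |P| ≤ H → |Q| ≤ H →
      |padeForm n n (n + 1) P Q| ≤ 2 ^ (5 * n + 3) * H ^ (n + 1) := fun P Q hP hQ => by
    exact (abs_padeForm_le n n (n + 1) P Q H hP hQ).trans (le_of_eq (by ring))
  have b2 : ∀ R P Q : ℤ, |R| ≤ H → |P| ≤ H → |Q| ≤ H →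
      |R * padeForm (n + 1) n n P Q| ≤ 2 ^ (5 * n + 3) * H ^ (n + 1) := fun R P Q hR hP hQ => by
    rw [abs_mul]
    have := abs_padeForm_le (n + 1) n n P Q H hP hQ
    calc |R| * |padeForm (n + 1) n n P Q| ≤
          H * (2 ^ (n + 1 + n) * 2 ^ (n + 1 + n + n + 1) * H ^ n) := by gcongr
      _ = 2 ^ (5 * n + 3) * H ^ (n + 1) := by ring
  have b3 : ∀ R P Q : ℤ, |R| ≤ H → |P| ≤ H → |Q| ≤ H →
      |R * padeForm n (n + 1) n P Q| ≤ 2 ^ (5 * n + 3) * H ^ (n + 1) := fun R P Q hR hP hQ => by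
    rw [abs_mul]
    have := abs_padeForm_le n (n + 1) n P Q H hP hQ
    calc |R| * |padeForm n (n + 1) n P Q| ≤
          H * (2 ^ (n + n) * 2 ^ (n + (n + 1) + n + 1) * H ^ n) := by gcongr
      _ = 2 ^ (5 * n + 2) * H ^ (n + 1) := by ring
      _ ≤ 2 ^ (5 * n + 3) * H ^ (n + 1) := by gcongr <;> norm_num
  by_contra! hcon
  have e1 := hcon _ _ _ (b2 Y X Z hYH hXH hZH) (b1 Y X hYH hXH) (b3 Y Z Y hYH hZH hYH) r1
  have e2 := hcon _ _ _ (b3 Z X Z hZH hXH hZH) (b2 Z Y X hZH hYH hXH) (b1 Z Y hZH hYH) r2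
  apply hm
  have hne : y * Z ^ (2 * n + 2) ≠ 0 := mul_ne_zero hy (pow_ne_zero _ hZ)
  apply mul_left_cancel₀ hne
  linear_combination (padeForm n n (n + 1) Y X) * e2 - (Z * padeForm (n + 1) n n Y X) * e1

/-- Coprime representatives, with negative last coordinate, of the points with nonzero coordinates
on the projective line `x 0 + x 1 + x 2 = 0`. -/
structure IsTriple (x : Fin 3 → ℤ) : Prop where
  sum_eq : x 0 + x 1 + x 2 = 0
  ne_zero : ∀ i, x i ≠ 0
  coprime : ∀ i j, i ≠ j → IsCoprime (x i) (x j)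
  neg : x 2 < 0

/-- The height of a triple. -/
def tripleHeight (x : Fin 3 → ℤ) : ℤ := max (max |x 0| |x 1|) |x 2|

/-- The valuation at `p` of the product of the coordinates. -/
def tripleVal (x : Fin 3 → ℤ) (p : ℕ) : ℕ := (x 0 * x 1 * x 2).natAbs.factorization p

/-- The part of `n` composed of primes outside `S`. -/
def outPart (S : Finset ℕ) (n : ℕ) : ℕ :=
  ∏ p ∈ n.primeFactors with p ∉ S, p ^ n.factorization p

/-- Minus the logarithm of the local distance of a triple to the three coordinate points. -/
noncomputable def localLog {S : Finset ℕ} (x : Fin 3 → ℤ) : Option S → ℝ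
  | some p => tripleVal x p * Real.log (p : ℕ)
  | none => 3 * Real.log (tripleHeight x : ℝ) - Real.log (|x 0 * x 1 * x 2| : ℤ)

/-- The coordinate `i` is the one which is small at the given place. -/
def IsSmallAt {S : Finset ℕ} (x : Fin 3 → ℤ) (i : Fin 3) : Option S → Prop
  | some p => ((p : ℕ) : ℤ) ^ tripleVal x p ∣ x i
  | none => |x i| * tripleHeight x ^ 2 ≤ 2 * |x 0 * x 1 * x 2|

lemma prod_mul_outPart (S : Finset ℕ) (hP : ∀ p ∈ S, p.Prime) {n : ℕ} (hn : n ≠ 0) :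
    (∏ p ∈ S, p ^ n.factorization p) * outPart S n = n := by
  conv_rhs => rw [← Nat.prod_factorization_pow_eq_self hn, Finsupp.prod, Nat.support_factorization,
    ← Finset.prod_filter_mul_prod_filter_not _ (· ∈ S)]
  rw [outPart]
  congr 1
  symm
  apply Finset.prod_subset
  · intro p hp; exact (Finset.mem_filter.mp hp).2
  · intro p hp hp'
    have : ¬ p ∣ n := fun h => hp' (by simp [hP p hp, h, hn, hp])
    simp [Nat.factorization_eq_zero_of_not_dvd this]

lemma outPart_pos (S : Finset ℕ) (n : ℕ) : 0 < outPart S n :=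
  Finset.prod_pos fun _ hp => pow_pos (Nat.pos_of_mem_primeFactors (Finset.mem_filter.mp hp).1) _

lemma outPart_congr (S : Finset ℕ) {m n : ℕ}
    (h : ∀ p, p.Prime → p ∉ S → m.factorization p = n.factorization p) :
    outPart S m = outPart S n := by
  have hs : ∀ p, p ∉ S → m.factorization p = n.factorization p := fun p hp => by
    by_cases hpp : p.Prime
    · exact h p hpp hp
    · simp [Nat.factorization_eq_zero_of_not_prime _ hpp]
  unfold outPart
  refine Finset.prod_congr ?_ fun p hp => by rw [hs p (Finset.mem_filter.mp hp).2]
  ext p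
  simp only [Finset.mem_filter, ← Nat.support_factorization, Finsupp.mem_support_iff]
  exact and_congr_left fun hp => by rw [hs p hp]

lemma IsTriple.prod_ne_zero {x : Fin 3 → ℤ} (hx : IsTriple x) : x 0 * x 1 * x 2 ≠ 0 :=
  mul_ne_zero (mul_ne_zero (hx.ne_zero 0) (hx.ne_zero 1)) (hx.ne_zero 2)

lemma abs_le_tripleHeight (x : Fin 3 → ℤ) (i : Fin 3) : |x i| ≤ tripleHeight x := by
  unfold tripleHeight
  fin_cases i <;> simp

lemma IsTriple.height_pos {x : Fin 3 → ℤ} (hx : IsTriple x) : 0 < tripleHeight x :=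
  (abs_pos.mpr (hx.ne_zero 0)).trans_le (abs_le_tripleHeight x 0)

lemma IsTriple.exists_abs_le {x : Fin 3 → ℤ} (hx : IsTriple x) :
    (∃ i, |x i| * tripleHeight x ^ 2 ≤ 2 * |x 0 * x 1 * x 2|) ∧
      |x 0 * x 1 * x 2| < tripleHeight x ^ 3 := by
  have key : ∀ (a b : ℤ), 0 < a → a ≤ b → a * (a + b) ^ 2 ≤ 2 * (a * b * (a + b)) ∧
      a * b * (a + b) < (a + b) ^ 3 := fun a b ha hab => by
    have hb : 0 < b := by linarith
    have h1 : 0 < a * (a + b) := by positivity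
    constructor
    · nlinarith
    · have : a * b < (a + b) ^ 2 := by nlinarith
      nlinarith
  have h0 := abs_pos.mpr (hx.ne_zero 0)
  have h1 := abs_pos.mpr (hx.ne_zero 1)
  have h2 := abs_pos.mpr (hx.ne_zero 2)
  have hs := hx.sum_eq
  rw [abs_mul, abs_mul]
  have hcases : |x 0| = |x 1| + |x 2| ∨ |x 1| = |x 0| + |x 2| ∨ |x 2| = |x 0| + |x 1| := by
    rcases abs_cases (x 0) with h | h <;> rcases abs_cases (x 1) with h' | h' <;>
      rcases abs_cases (x 2) with h'' | h'' <;> omega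
  have main : ∀ i j k : Fin 3, 0 < |x i| → 0 < |x j| → |x k| = |x i| + |x j| →
      |x 0| * |x 1| * |x 2| = |x i| * |x j| * |x k| → tripleHeight x = |x k| →
      (∃ i, |x i| * tripleHeight x ^ 2 ≤ 2 * (|x 0| * |x 1| * |x 2|)) ∧
        |x 0| * |x 1| * |x 2| < tripleHeight x ^ 3 := by
    intro i j k hi hj hk hp hh
    rw [hp, hh, hk]
    rcases le_total |x i| |x j| with hij | hij
    · exact ⟨⟨i, (key _ _ hi hij).1⟩, (key _ _ hi hij).2⟩
    · have := key _ _ hj hij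
      rw [add_comm |x j|, mul_comm |x j| |x i|] at this
      exact ⟨⟨j, this.1⟩, this.2⟩
  rcases hcases with h | h | h
  · exact main 1 2 0 h1 h2 h (by ring) (by unfold tripleHeight; omega)
  · exact main 0 2 1 h0 h2 h (by ring) (by unfold tripleHeight; omega)
  · exact main 0 1 2 h0 h1 h (by ring) (by unfold tripleHeight; omega)

lemma IsTriple.exists_pow_dvd {x : Fin 3 → ℤ} (hx : IsTriple x) {p : ℕ} (hp : p.Prime) :
    ∃ i, (p : ℤ) ^ tripleVal x p ∣ x i := by
  have hdvd : (p : ℤ) ^ tripleVal x p ∣ x 0 * x 1 * x 2 := by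
    rw [← Int.natCast_pow, Int.natCast_dvd]
    exact Nat.ordProj_dvd _ _
  have hpi : Prime (p : ℤ) := Nat.prime_iff_prime_int.mp hp
  have hcop : ∀ i, (p : ℤ) ∣ x i → ∀ j, j ≠ i → IsCoprime ((p : ℤ) ^ tripleVal x p) (x j) :=
    fun i hi j hj => IsCoprime.pow_left ((hx.coprime i j hj.symm).of_isCoprime_of_dvd_left hi)
  by_cases h : tripleVal x p = 0
  · exact ⟨0, by simp [h]⟩
  have hd : (p : ℤ) ∣ x 0 * x 1 * x 2 := (dvd_pow_self _ h).trans hdvd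
  rcases hpi.dvd_or_dvd hd with hd | hd
  · rcases hpi.dvd_or_dvd hd with hd | hd
    · exact ⟨0, (hcop 0 hd 1 (by decide)).dvd_of_dvd_mul_right
        ((hcop 0 hd 2 (by decide)).dvd_of_dvd_mul_right hdvd)⟩
    · exact ⟨1, (hcop 1 hd 0 (by decide)).dvd_of_dvd_mul_left
        ((hcop 1 hd 2 (by decide)).dvd_of_dvd_mul_right hdvd)⟩
  · exact ⟨2, ((hcop 2 hd 0 (by decide)).mul_right (hcop 2 hd 1 (by decide))).dvd_of_dvd_mul_left
      hdvd⟩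

lemma IsTriple.exists_isSmallAt {S : Finset ℕ} (hP : ∀ p ∈ S, p.Prime) {x : Fin 3 → ℤ}
    (hx : IsTriple x) (v : Option S) : ∃ i, IsSmallAt x i v := by
  cases v with
  | none => exact hx.exists_abs_le.1
  | some p => exact hx.exists_pow_dvd (hP p p.2)

lemma IsTriple.localLog_none_pos {S : Finset ℕ} {x : Fin 3 → ℤ} (hx : IsTriple x) :
    0 < localLog x (none : Option S) := by
  have h1 : ((|x 0 * x 1 * x 2| : ℤ) : ℝ) < (tripleHeight x : ℝ) ^ 3 := by
    exact_mod_cast hx.exists_abs_le.2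
  have h2 := Real.log_lt_log (by exact_mod_cast abs_pos.mpr hx.prod_ne_zero) h1
  rw [Real.log_pow] at h2
  simp only [localLog]
  push_cast at h2 ⊢
  linarith

lemma IsTriple.localLog_nonneg {S : Finset ℕ} {x : Fin 3 → ℤ}
    (hx : IsTriple x) (v : Option S) : 0 ≤ localLog x v := by
  cases v with
  | none => exact hx.localLog_none_pos.le
  | some p => exact mul_nonneg (Nat.cast_nonneg _) (Real.log_natCast_nonneg _)

lemma IsTriple.sum_localLog {S : Finset ℕ} (hP : ∀ p ∈ S, p.Prime) {x : Fin 3 → ℤ}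
    (hx : IsTriple x) : ∑ v : Option S, localLog x v =
      3 * Real.log (tripleHeight x : ℝ) - Real.log (outPart S (x 0 * x 1 * x 2).natAbs : ℝ) := by
  have h := prod_mul_outPart S hP (Int.natAbs_ne_zero.mpr hx.prod_ne_zero)
  have h2 := congrArg (fun n : ℕ => Real.log (n : ℝ)) h
  have hne : ∀ p ∈ S, ((p : ℝ) ^ (x 0 * x 1 * x 2).natAbs.factorization p) ≠ 0 := fun p hp =>
    pow_ne_zero _ (by exact_mod_cast (hP p hp).ne_zero)
  rw [Nat.cast_mul, Nat.cast_prod, Real.log_mul, Real.log_prod] at h2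
  · rw [Fintype.sum_option]
    simp only [localLog]
    rw [Finset.sum_coe_sort S (fun p => (tripleVal x p : ℝ) * Real.log (p : ℝ))]
    simp only [tripleVal]
    simp only [Nat.cast_pow, Real.log_pow, Nat.cast_natAbs] at h2
    linarith
  · intro p hp; exact_mod_cast hne p hp
  · push_cast; exact Finset.prod_ne_zero_iff.mpr hne
  · exact_mod_cast Nat.ne_of_gt (outPart_pos S _)

/-- Two triples with the same valuations outside `S`. -/
def SameOutside (S : Finset ℕ) (x y : Fin 3 → ℤ) : Prop :=
  ∀ p, p.Prime → p ∉ S → ∀ i, (x i).natAbs.factorization p = (y i).natAbs.factorization p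

lemma outPart_mul_prod_dvd (S : Finset ℕ) (hP : ∀ p ∈ S, p.Prime) {x y : Fin 3 → ℤ}
    (hx : IsTriple x) (hy : IsTriple y) (hxy : SameOutside S x y) {k : ℕ} (hk : 1 ≤ k) {E : ℤ}
    (hE : ∀ i, ∃ U V, E = y i * U + x i ^ k * V) (f : ℕ → ℕ)
    (hf : ∀ p ∈ S, (p : ℤ) ^ f p ∣ E) :
    ((outPart S (x 0 * x 1 * x 2).natAbs * ∏ p ∈ S, p ^ f p : ℕ) : ℤ) ∣ E := by
  set P := (x 0 * x 1 * x 2).natAbs.primeFactors.filter (· ∉ S) with hPdef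
  have hdisj : Disjoint P S := by
    rw [Finset.disjoint_left]
    intro p hp
    exact (Finset.mem_filter.mp hp).2
  have heq : outPart S (x 0 * x 1 * x 2).natAbs * ∏ p ∈ S, p ^ f p =
      ∏ p ∈ P ∪ S, p ^ (if p ∈ S then f p else tripleVal x p) := by
    rw [Finset.prod_union hdisj]
    congr 1
    · refine Finset.prod_congr rfl fun p hp => ?_
      rw [if_neg (Finset.mem_filter.mp hp).2, tripleVal]
    · exact Finset.prod_congr rfl fun p hp => by rw [if_pos hp]
  have hprime : ∀ p ∈ P ∪ S, p.Prime := fun p hp => by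
    rcases Finset.mem_union.mp hp with hp | hp
    · exact Nat.prime_of_mem_primeFactors (Finset.mem_filter.mp hp).1
    · exact hP p hp
  rw [heq, Nat.cast_prod]
  refine Finset.prod_dvd_of_coprime ?_ ?_
  · intro p hp q hq hpq
    simp only [Function.onFun]
    rw [Nat.isCoprime_iff_coprime]
    exact Nat.Coprime.pow _ _ ((Nat.coprime_primes (hprime p hp) (hprime q hq)).mpr hpq)
  · intro p hp
    by_cases hpS : p ∈ S
    · simpa [hpS] using hf p hpS
    · rw [if_neg hpS, Nat.cast_pow]
      have hpp := hprime p hp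
      obtain ⟨i, hi⟩ := hx.exists_pow_dvd hpp
      have hi' : (p : ℤ) ^ tripleVal x p ∣ y i := by
        rw [← Int.natCast_pow, Int.natCast_dvd] at hi ⊢
        rw [hpp.pow_dvd_iff_le_factorization (Int.natAbs_ne_zero.mpr (hy.ne_zero i)),
          ← hxy p hpp hpS i]
        exact (hpp.pow_dvd_iff_le_factorization (Int.natAbs_ne_zero.mpr (hx.ne_zero i))).mp hi
      obtain ⟨U, V, rfl⟩ := hE i
      exact dvd_add (hi'.mul_right _) ((hi.trans (dvd_pow_self _ (by omega))).mul_right _)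

lemma IsTriple.abs_le_of_isSmallAt {S : Finset ℕ} {x : Fin 3 → ℤ} (hx : IsTriple x) {i : Fin 3}
    (h : IsSmallAt x i (none : Option S)) :
    |(x i : ℝ)| ≤ 2 * (tripleHeight x * Real.exp (-localLog x (none : Option S))) := by
  have hH : (0 : ℝ) < tripleHeight x := by exact_mod_cast hx.height_pos
  have hp : (0 : ℝ) < (|x 0 * x 1 * x 2| : ℤ) := by exact_mod_cast abs_pos.mpr hx.prod_ne_zero
  have he : Real.exp (-localLog x (none : Option S)) =
      (|x 0 * x 1 * x 2| : ℤ) / (tripleHeight x : ℝ) ^ 3 := by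
    rw [localLog, neg_sub, Real.exp_sub, Real.exp_log hp,
      show (3 : ℝ) * Real.log (tripleHeight x) = ((3 : ℕ) : ℝ) * Real.log (tripleHeight x) by norm_num,
      ← Real.log_pow, Real.exp_log (by positivity)]
  have hreal : |(x i : ℝ)| * (tripleHeight x : ℝ) ^ 2 ≤ 2 * (|x 0 * x 1 * x 2| : ℤ) := by
    have : |x i| * tripleHeight x ^ 2 ≤ 2 * |x 0 * x 1 * x 2| := h
    exact_mod_cast this
  rw [he]
  have e : 2 * ((tripleHeight x : ℝ) * ((|x 0 * x 1 * x 2| : ℤ) / (tripleHeight x : ℝ) ^ 3)) =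
      2 * (|x 0 * x 1 * x 2| : ℤ) / (tripleHeight x : ℝ) ^ 2 := by
    field_simp
  rw [e, le_div_iff₀ (by positivity)]
  exact hreal

/-- The basic inequality between two triples that are close to the same coordinate points at the
places of `S`, given a relation between the powers of the first one. -/
lemma log_outPart_le (S : Finset ℕ) (hP : ∀ p ∈ S, p.Prime) {x y : Fin 3 → ℤ}
    (hx : IsTriple x) (hy : IsTriple y) (hxy : SameOutside S x y) {k : ℕ} (hk : 1 ≤ k)
    {Γ : Option S → ℝ} {ind : Option S → Fin 3} {μ : ℝ}
    (hΓx : ∀ v, Γ v * μ ≤ k * localLog x v) (hΓy : ∀ v, Γ v * μ ≤ localLog y v)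
    (hix : ∀ v, Γ v ≠ 0 → IsSmallAt x (ind v) v) (hiy : ∀ v, Γ v ≠ 0 → IsSmallAt y (ind v) v)
    {M : ℝ} (hM : 0 < M) {α β γ : ℤ} (hα : |(α : ℝ)| ≤ M) (hβ : |(β : ℝ)| ≤ M)
    (hγ : |(γ : ℝ)| ≤ M) (hrel : x 0 ^ k * α + x 1 ^ k * β + x 2 ^ k * γ = 0)
    (hne : y 1 * (x 2 ^ k * γ) - y 2 * (x 1 ^ k * β) ≠ 0) :
    Real.log (outPart S (x 0 * x 1 * x 2).natAbs) ≤ (k + 1) * Real.log 2 + Real.log M +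
      k * Real.log (tripleHeight x) + Real.log (tripleHeight y) - (∑ v, Γ v) * μ := by
  set E : ℤ := y 1 * (x 2 ^ k * γ) - y 2 * (x 1 ^ k * β) with hEdef
  set H : ℝ := (tripleHeight x : ℝ) with hHdef
  set H' : ℝ := (tripleHeight y : ℝ) with hH'def
  have hH : 0 < H := by rw [hHdef]; exact_mod_cast hx.height_pos
  have hH' : 0 < H' := by rw [hH'def]; exact_mod_cast hy.height_pos
  have hxH : ∀ i, |(x i : ℝ)| ≤ H := fun i => by
    rw [hHdef]; exact_mod_cast abs_le_tripleHeight x i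
  have hyH : ∀ i, |(y i : ℝ)| ≤ H' := fun i => by
    rw [hH'def]; exact_mod_cast abs_le_tripleHeight y i
  have bU : ∀ (i : Fin 3) (c : ℤ), |(c : ℝ)| ≤ M → |((x i ^ k * c : ℤ) : ℝ)| ≤ H ^ k * M :=
    fun i c hc => by
      push_cast
      rw [abs_mul, abs_pow]
      have := hxH i
      gcongr
  have bV : ∀ (i : Fin 3) (c : ℤ), |(c : ℝ)| ≤ M → |((y i * c : ℤ) : ℝ)| ≤ H' * M :=
    fun i c hc => by
      push_cast
      rw [abs_mul]
      have := hyH i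
      gcongr
  have hE : ∀ i, ∃ U V : ℤ, |(U : ℝ)| ≤ H ^ k * M ∧ |(V : ℝ)| ≤ H' * M ∧
      E = y i * U + x i ^ k * V := by
    have hx0 : x 0 ^ k * α = -(x 1 ^ k * β) - x 2 ^ k * γ := by linarith
    have hy0 : y 0 = -y 1 - y 2 := by linarith [hy.sum_eq]
    intro i
    fin_cases i
    · refine ⟨x 1 ^ k * β, -(y 1 * α), bU 1 β hβ, ?_, ?_⟩
      · rw [Int.cast_neg, abs_neg]; exact bV 1 α hα
      · simp only [hEdef, Fin.zero_eta]
        rw [hy0]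
        linear_combination (y 1) * hx0
    · refine ⟨x 2 ^ k * γ, -(y 2 * β), bU 2 γ hγ, ?_, ?_⟩
      · rw [Int.cast_neg, abs_neg]; exact bV 2 β hβ
      · simp only [hEdef, Fin.mk_one]
        ring
    · refine ⟨-(x 1 ^ k * β), y 1 * γ, ?_, bV 1 γ hγ, ?_⟩
      · rw [Int.cast_neg, abs_neg]; exact bU 1 β hβ
      · simp only [hEdef, Fin.reduceFinMk]
        ring
  have harch : Real.log |(E : ℝ)| ≤ (k + 1) * Real.log 2 + Real.log M + k * Real.log H +
      Real.log H' - Γ none * μ := by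
    have hb : |(E : ℝ)| ≤ 2 ^ (k + 1) * M * H ^ k * H' * Real.exp (-(Γ none * μ)) := by
      have h2k : (2 : ℝ) ≤ 2 ^ k := by
        simpa using pow_le_pow_right₀ (one_le_two : (1 : ℝ) ≤ 2) hk
      have step : ∀ (i : Fin 3) (e : ℝ), 0 ≤ e → |(y i : ℝ)| ≤ 2 * (H' * e) →
          |(x i : ℝ)| ^ k ≤ 2 ^ k * (H ^ k * e) → |(E : ℝ)| ≤ 2 ^ (k + 1) * M * H ^ k * H' * e := by
        intro i e he h1 h2
        obtain ⟨U, V, hU, hV, hEi⟩ := hE i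
        rw [hEi]
        push_cast
        calc |(y i : ℝ) * U + (x i : ℝ) ^ k * V| ≤ |(y i : ℝ)| * |(U : ℝ)| +
              |(x i : ℝ)| ^ k * |(V : ℝ)| := by
              rw [← abs_mul, ← abs_pow, ← abs_mul]; exact abs_add_le _ _
          _ ≤ 2 * (H' * e) * (H ^ k * M) + 2 ^ k * (H ^ k * e) * (H' * M) := by gcongr
          _ = (2 + 2 ^ k) * (M * H ^ k * H' * e) := by ring
          _ ≤ (2 ^ k + 2 ^ k) * (M * H ^ k * H' * e) := by gcongr
          _ = 2 ^ (k + 1) * M * H ^ k * H' * e := by ring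
      by_cases h0 : Γ none = 0
      · rw [h0]
        refine step 0 _ (Real.exp_nonneg _) ?_ ?_
        · simp only [zero_mul, neg_zero, Real.exp_zero, mul_one]
          linarith [hyH 0]
        · simp only [zero_mul, neg_zero, Real.exp_zero, mul_one]
          have : |(x 0 : ℝ)| ^ k ≤ H ^ k := by gcongr; exact hxH 0
          have hpos : 0 < H ^ k := by positivity
          nlinarith
      · have h1 := hx.abs_le_of_isSmallAt (hix none h0)
        have h2 := hy.abs_le_of_isSmallAt (hiy none h0)
        refine step (ind none) _ (Real.exp_nonneg _) (h2.trans ?_) ?_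
        · have := hΓy none
          gcongr
        · calc |(x (ind none) : ℝ)| ^ k ≤
                (2 * (H * Real.exp (-localLog x (none : Option S)))) ^ k := by gcongr
            _ = 2 ^ k * (H ^ k * Real.exp (-(k * localLog x (none : Option S)))) := by
                rw [mul_pow, mul_pow, ← Real.exp_nat_mul, mul_neg]
            _ ≤ _ := by
                have := hΓx none
                gcongr
    have hEpos : 0 < |(E : ℝ)| := abs_pos.mpr (by exact_mod_cast hne)
    have := Real.log_le_log hEpos hb
    rw [Real.log_mul (by positivity) (by positivity), Real.log_exp,
      Real.log_mul (by positivity) (by positivity), Real.log_mul (by positivity) (by positivity),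
      Real.log_mul (by positivity) (by positivity), Real.log_pow, Real.log_pow] at this
    push_cast at this
    linarith
  classical
  let f : ℕ → ℕ := fun p => if h : p ∈ S then
    (if Γ (some ⟨p, h⟩) = 0 then 0 else min (tripleVal y p) (k * tripleVal x p)) else 0
  have hfdvd : ∀ p ∈ S, (p : ℤ) ^ f p ∣ E := by
    intro p hp
    simp only [f, hp, dite_true]
    split_ifs with h0
    · simp
    · have h1 : (p : ℤ) ^ tripleVal x p ∣ x (ind (some ⟨p, hp⟩)) := hix (some ⟨p, hp⟩) h0
      have h2 : (p : ℤ) ^ tripleVal y p ∣ y (ind (some ⟨p, hp⟩)) := hiy (some ⟨p, hp⟩) h0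
      obtain ⟨U, V, -, -, hEi⟩ := hE (ind (some ⟨p, hp⟩))
      rw [hEi]
      refine dvd_add (Dvd.dvd.mul_right ?_ _) (Dvd.dvd.mul_right ?_ _)
      · exact (pow_dvd_pow _ (min_le_left _ _)).trans h2
      · refine (pow_dvd_pow _ (min_le_right _ _)).trans ?_
        rw [mul_comm, pow_mul]
        exact pow_dvd_pow_of_dvd h1 k
  have hflog : ∀ p : S, Γ (some p) * μ ≤ f p * Real.log (p : ℕ) := by
    intro p
    have hlog : 0 ≤ Real.log (p : ℕ) := Real.log_natCast_nonneg _
    simp only [f, p.2, dite_true]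
    split_ifs with h0
    · simp [h0]
    · have h1 := hΓx (some p)
      have h2 := hΓy (some p)
      simp only [localLog] at h1 h2
      rw [Nat.cast_min, min_mul_of_nonneg _ _ hlog, Nat.cast_mul, mul_assoc]
      exact le_min h2 h1
  have hdvd := outPart_mul_prod_dvd S hP hx hy hxy hk
    (fun i => let ⟨U, V, _, _, h⟩ := hE i; ⟨U, V, h⟩) f hfdvd
  have hle := Int.le_of_dvd (abs_pos.mpr hne) ((dvd_abs _ _).mpr hdvd)
  have hle' : ((outPart S (x 0 * x 1 * x 2).natAbs : ℝ) * ∏ p ∈ S, (p : ℝ) ^ f p) ≤ |(E : ℝ)| := by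
    exact_mod_cast hle
  have hprodne : ∀ p ∈ S, ((p : ℝ) ^ f p) ≠ 0 := fun p hp =>
    pow_ne_zero _ (by exact_mod_cast (hP p hp).ne_zero)
  have hout : (0 : ℝ) < outPart S (x 0 * x 1 * x 2).natAbs := by exact_mod_cast outPart_pos S _
  have hlogle := Real.log_le_log (mul_pos hout (Finset.prod_pos fun p hp =>
    pow_pos (by exact_mod_cast (hP p hp).pos) _)) hle'
  rw [Real.log_mul hout.ne' (Finset.prod_ne_zero_iff.mpr hprodne), Real.log_prod hprodne] at hlogle
  have hsum : (∑ p : S, Γ (some p)) * μ ≤ ∑ p ∈ S, Real.log ((p : ℝ) ^ f p) := by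
    rw [← Finset.sum_coe_sort S (fun p => Real.log ((p : ℝ) ^ f p)), Finset.sum_mul]
    refine Finset.sum_le_sum fun p _ => ?_
    rw [Real.log_pow]
    exact hflog p
  rw [Fintype.sum_option, add_mul]
  linarith

lemma SameOutside.outPart_eq {S : Finset ℕ} {x y : Fin 3 → ℤ} (hx : IsTriple x) (hy : IsTriple y)
    (h : SameOutside S x y) :
    outPart S (x 0 * x 1 * x 2).natAbs = outPart S (y 0 * y 1 * y 2).natAbs := by
  refine outPart_congr S fun p hp hpS => ?_
  have hx' := fun i => Int.natAbs_ne_zero.mpr (hx.ne_zero i)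
  have hy' := fun i => Int.natAbs_ne_zero.mpr (hy.ne_zero i)
  simp only [Int.natAbs_mul]
  rw [Nat.factorization_mul (mul_ne_zero (hx' 0) (hx' 1)) (hx' 2),
    Nat.factorization_mul (hx' 0) (hx' 1),
    Nat.factorization_mul (mul_ne_zero (hy' 0) (hy' 1)) (hy' 2),
    Nat.factorization_mul (hy' 0) (hy' 1)]
  simp only [Finsupp.add_apply, h p hp hpS]

/-- The triple `x`, whose coordinates have product with part `K` outside `S`, has the approximation
pattern `c`: at the place `v` it is close to the coordinate point `(c v).2`, with exponent at
least `(c v).1 / (7 * #S)`. -/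
def HasPattern {S : Finset ℕ} (K : ℕ) (x : Fin 3 → ℤ) (c : Option S → ℕ × Fin 3) : Prop :=
  ∀ v, ((c v).1 : ℝ) * (3 * Real.log (tripleHeight x) - Real.log K) ≤ 7 * S.card * localLog x v ∧
    ((c v).1 ≠ 0 → IsSmallAt x (c v).2 v)

lemma HasPattern.log_le {S : Finset ℕ} (hP : ∀ p ∈ S, p.Prime) (hS : S.Nonempty) {K : ℕ}
    {x y : Fin 3 → ℤ} (hx : IsTriple x) (hy : IsTriple y) (hxy : SameOutside S x y)
    (hK : outPart S (x 0 * x 1 * x 2).natAbs = K) {c : Option S → ℕ × Fin 3}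
    (hc : ∑ v, (c v).1 = 6 * S.card) (hcx : HasPattern K x c) (hcy : HasPattern K y c)
    {k : ℕ} (hk : 1 ≤ k) {M : ℝ} (hM : 0 < M) {α β γ : ℤ} (hα : |(α : ℝ)| ≤ M)
    (hβ : |(β : ℝ)| ≤ M) (hγ : |(γ : ℝ)| ≤ M)
    (hrel : x 0 ^ k * α + x 1 ^ k * β + x 2 ^ k * γ = 0)
    (hne : y 1 * (x 2 ^ k * γ) - y 2 * (x 1 ^ k * β) ≠ 0) :
    Real.log K ≤ (k + 1) * Real.log 2 + Real.log M + k * Real.log (tripleHeight x) +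
      Real.log (tripleHeight y) - 6 / 7 * min (3 * Real.log (tripleHeight y) - Real.log K)
        (k * (3 * Real.log (tripleHeight x) - Real.log K)) := by
  have ht : (0 : ℝ) < S.card := by exact_mod_cast hS.card_pos
  set μ := min (3 * Real.log (tripleHeight y) - Real.log K)
        (k * (3 * Real.log (tripleHeight x) - Real.log K)) with hμ
  have h := log_outPart_le S hP hx hy hxy hk (Γ := fun v => ((c v).1 : ℝ) / (7 * S.card))
    (ind := fun v => (c v).2) (μ := μ) ?_ ?_ (fun v hv => (hcx v).2 ?_) (fun v hv => (hcy v).2 ?_)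
    hM hα hβ hγ hrel hne
  · rw [hK, ← Finset.sum_div, ← Nat.cast_sum, hc] at h
    have e : ((6 * S.card : ℕ) : ℝ) / (7 * S.card) = 6 / 7 := by
      push_cast; field_simp
    rw [e] at h
    exact h
  · intro v
    have h1 := (hcx v).1
    have h2 : μ ≤ k * (3 * Real.log (tripleHeight x) - Real.log K) := min_le_right _ _
    rw [div_mul_eq_mul_div, div_le_iff₀ (by positivity)]
    calc ((c v).1 : ℝ) * μ ≤ (c v).1 * (k * (3 * Real.log (tripleHeight x) - Real.log K)) := by
          gcongr
      _ = k * ((c v).1 * (3 * Real.log (tripleHeight x) - Real.log K)) := by ring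
      _ ≤ k * (7 * S.card * localLog x v) := by gcongr
      _ = _ := by ring
  · intro v
    have h1 := (hcy v).1
    have h2 : μ ≤ 3 * Real.log (tripleHeight y) - Real.log K := min_le_left _ _
    rw [div_mul_eq_mul_div, div_le_iff₀ (by positivity)]
    calc ((c v).1 : ℝ) * μ ≤ (c v).1 * (3 * Real.log (tripleHeight y) - Real.log K) := by
          gcongr
      _ ≤ _ := by linarith
  · intro h0; simp [h0] at hv
  · intro h0; simp [h0] at hv

lemma IsTriple.ext {x y : Fin 3 → ℤ} (hx : IsTriple x) (hy : IsTriple y)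
    (h : y 1 * x 2 = y 2 * x 1) : x = y := by
  have d1 : x 2 ∣ y 2 :=
    (hx.coprime 2 1 (by decide)).dvd_of_dvd_mul_right ⟨y 1, by linarith⟩
  have d2 : y 2 ∣ x 2 :=
    (hy.coprime 2 1 (by decide)).dvd_of_dvd_mul_left ⟨x 1, by linarith⟩
  have e2 : x 2 = y 2 := by
    have h1 := Int.le_of_dvd (neg_pos.mpr hx.neg) (dvd_neg.mpr (neg_dvd.mpr d2) : -y 2 ∣ -x 2)
    have h2 := Int.le_of_dvd (neg_pos.mpr hy.neg) (dvd_neg.mpr (neg_dvd.mpr d1) : -x 2 ∣ -y 2)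
    linarith
  have e1 : x 1 = y 1 := by
    rw [e2, mul_comm] at h
    exact (mul_left_cancel₀ hy.neg.ne h).symm
  have e0 : x 0 = y 0 := by linarith [hx.sum_eq, hy.sum_eq]
  funext i
  fin_cases i
  · exact e0
  · exact e1
  · exact e2

section Pattern

variable {S : Finset ℕ} (hP : ∀ p ∈ S, p.Prime) (hS : S.Nonempty) {K : ℕ}
  {x y : Fin 3 → ℤ} (hx : IsTriple x) (hy : IsTriple y) (hxy : SameOutside S x y)
  (hK : outPart S (x 0 * x 1 * x 2).natAbs = K) {c : Option S → ℕ × Fin 3}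
  (hc : ∑ v, (c v).1 = 6 * S.card) (hcx : HasPattern K x c) (hcy : HasPattern K y c)
include hP hS hx hy hxy hK hc hcx hcy

lemma HasPattern.gap (hne : x ≠ y) (hle : Real.log (tripleHeight x) ≤ Real.log (tripleHeight y)) :
    11 / 7 * (Real.log (tripleHeight x) - 7 / 2 * Real.log 2) ≤
      Real.log (tripleHeight y) - 7 / 2 * Real.log 2 := by
  have h := HasPattern.log_le hP hS hx hy hxy hK hc hcx hcy (le_refl 1) (M := 1) one_pos
    (α := 1) (β := 1) (γ := 1) (by simp) (by simp) (by simp) (by linarith [hx.sum_eq])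
    (fun h => hne (hx.ext hy (by linarith)))
  rw [Nat.cast_one, one_mul, one_mul, Real.log_one, min_eq_right (by linarith)] at h
  have hk : 0 ≤ Real.log K := Real.log_natCast_nonneg K
  linarith

lemma HasPattern.pade (n : ℕ) :
    Real.log K ≤ (7 * n + 6) * Real.log 2 + 3 * (n + 1) * Real.log (tripleHeight x) +
      Real.log (tripleHeight y) - 6 / 7 * min (3 * Real.log (tripleHeight y) - Real.log K)
        (2 * (n + 1) * (3 * Real.log (tripleHeight x) - Real.log K)) := by
  have hH : (0 : ℝ) < tripleHeight x := by exact_mod_cast hx.height_pos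
  obtain ⟨α, β, γ, hα, hβ, hγ, hrel, hne⟩ := exists_pade_relation n hx.sum_eq (hx.ne_zero 0)
    (hx.ne_zero 2) (abs_le_tripleHeight x 0) (abs_le_tripleHeight x 1) (abs_le_tripleHeight x 2)
    (hy.ne_zero 1) (z := y 2)
  have h := HasPattern.log_le hP hS hx hy hxy hK hc hcx hcy (k := 2 * n + 2) (by omega)
    (M := 2 ^ (5 * n + 3) * (tripleHeight x : ℝ) ^ (n + 1)) (by positivity)
    (by exact_mod_cast hα) (by exact_mod_cast hβ) (by exact_mod_cast hγ) hrel hne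
  rw [Real.log_mul (by positivity) (by positivity), Real.log_pow, Real.log_pow] at h
  push_cast at h
  rw [show (2 * (n : ℝ) + 2) = 2 * (n + 1) by ring] at h
  linarith

end Pattern

lemma le_of_forall_pade {h h' κ l : ℝ} (hl : 0 < l) (hκ : 0 ≤ κ) (hh : 40 * κ + 280 * l ≤ h)
    (hn : ∀ n : ℕ, κ ≤ (7 * n + 6) * l + 3 * (n + 1) * h + h' -
      6 / 7 * min (3 * h' - κ) (2 * (n + 1) * (3 * h - κ))) : h' ≤ 20 * h := by
  by_contra! hcon
  set P := (21 * h + 49 * l) / 11 with hPdef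
  have hPpos : 0 < P := by rw [hPdef]; linarith
  have key : ∀ n : ℕ, P * (n + 10) < h' := by
    intro n
    induction n with
    | zero => rw [hPdef]; push_cast; linarith
    | succ n ih =>
      have hn0 : (0 : ℝ) ≤ n := Nat.cast_nonneg n
      have h1 := hn (n + 9)
      push_cast at h1 ⊢
      rcases min_choice (3 * h' - κ) (2 * ((n : ℝ) + 9 + 1) * (3 * h - κ)) with hm | hm
      · rw [hm] at h1
        exfalso
        rw [hPdef] at ih
        nlinarith
      · rw [hm] at h1
        have e : P * (n + 1 + 10) ≤ (15 / 7 * h - 12 / 7 * κ - 7 * l) * (n + 10) := by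
          have : 11 / 10 * P < 15 / 7 * h - 12 / 7 * κ - 7 * l := by rw [hPdef]; linarith
          nlinarith
        nlinarith
  obtain ⟨n, hn⟩ := exists_nat_gt (h' / P)
  rw [div_lt_iff₀ hPpos] at hn
  nlinarith [key n]

lemma exists_pow_card_mul_le {ι : Type*} (F : Finset ι) (hF : F.Nonempty) (g : ι → ℝ) {r : ℝ}
    (hr : 0 ≤ r) (h : ∀ a ∈ F, ∀ b ∈ F, a ≠ b → g a ≤ g b → r * g a ≤ g b) :
    ∃ a ∈ F, ∃ b ∈ F, r ^ (F.card - 1) * g a ≤ g b := by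
  classical
  induction F using Finset.induction_on_max_value g with
  | empty => simp at hF
  | insert a s has hmax ih =>
    rcases s.eq_empty_or_nonempty with rfl | hs
    · exact ⟨a, by simp, a, by simp, by simp⟩
    obtain ⟨u, hu, v, hv, huv⟩ := ih hs fun b hb c hc => h b (by simp [hb]) c (by simp [hc])
    refine ⟨u, by simp [hu], a, by simp, ?_⟩
    have := h v (by simp [hv]) a (by simp) (fun e => has (e ▸ hv)) (hmax v hv)
    rw [Finset.card_insert_of_notMem has, Nat.add_sub_cancel]
    have hc := hs.card_pos
    obtain ⟨m, hm⟩ : ∃ m, s.card = m + 1 := ⟨s.card - 1, by omega⟩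
    rw [hm, Nat.add_sub_cancel] at huv
    rw [hm, pow_succ']
    nlinarith

/-- At most 22 triples of height at least 32 share an approximation pattern. -/
lemma card_le_of_hasPattern {S : Finset ℕ} (hP : ∀ p ∈ S, p.Prime) (hS : S.Nonempty) {K : ℕ}
    {c : Option S → ℕ × Fin 3} (hc : ∑ v, (c v).1 = 6 * S.card) (F : Finset (Fin 3 → ℤ))
    (hF : ∀ x ∈ F, IsTriple x ∧ outPart S (x 0 * x 1 * x 2).natAbs = K ∧ 32 ≤ tripleHeight x ∧
      HasPattern K x c) (hF' : ∀ x ∈ F, ∀ y ∈ F, SameOutside S x y) : F.card ≤ 22 := by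
  have hl : 0 < Real.log 2 := Real.log_pos (by norm_num)
  have hk : 0 ≤ Real.log K := Real.log_natCast_nonneg K
  have hlarge : ∀ x ∈ F, 5 * Real.log 2 ≤ Real.log (tripleHeight x) := fun x hx => by
    have h32 : ((2 : ℝ) ^ 5) ≤ tripleHeight x := by
      have := (hF x hx).2.2.1
      have h' : ((32 : ℤ) : ℝ) ≤ tripleHeight x := by exact_mod_cast this
      norm_num at h' ⊢
      exact h'
    have := Real.log_le_log (by positivity) h32
    rw [Real.log_pow] at this
    exact_mod_cast this
  have hgap : ∀ G ⊆ F, G.Nonempty → ∃ a ∈ G, ∃ b ∈ G, (11 / 7 : ℝ) ^ (G.card - 1) *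
      (Real.log (tripleHeight a) - 7 / 2 * Real.log 2) ≤
        Real.log (tripleHeight b) - 7 / 2 * Real.log 2 := fun G hG hGne =>
    exists_pow_card_mul_le G hGne (fun a => Real.log (tripleHeight a) - 7 / 2 * Real.log 2)
      (by norm_num) fun a ha b hb hab hle => HasPattern.gap hP hS (hF a (hG ha)).1 (hF b (hG hb)).1
        (hF' a (hG ha) b (hG hb)) (hF a (hG ha)).2.1 hc (hF a (hG ha)).2.2.2 (hF b (hG hb)).2.2.2
        hab (by linarith)
  classical
  rw [← Finset.card_filter_add_card_filter_not
    (fun x => Real.log (tripleHeight x : ℝ) < 40 * Real.log K + 280 * Real.log 2)]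
  have h1 : (F.filter (fun x => Real.log (tripleHeight x : ℝ) <
      40 * Real.log K + 280 * Real.log 2)).card ≤ 15 := by
    set G := F.filter (fun x => Real.log (tripleHeight x : ℝ) < 40 * Real.log K + 280 * Real.log 2)
      with hG
    by_contra! hcard
    obtain ⟨a, ha, b, hb, hab⟩ := hgap G (Finset.filter_subset _ _)
      (Finset.card_pos.mp (by omega))
    have hb' := (Finset.mem_filter.mp hb).2
    have haF := (Finset.mem_filter.mp ha).1
    have ha5 := hlarge a haF
    have hpos := (hF a haF).1.localLog_none_pos (S := S)
    have hsum := (hF a haF).1.sum_localLog hP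
    rw [(hF a haF).2.1] at hsum
    have hnn : 0 ≤ ∑ v : Option S, localLog a v :=
      Finset.sum_nonneg fun v _ => (hF a haF).1.localLog_nonneg v
    have hpow : (879 : ℝ) ≤ (11 / 7 : ℝ) ^ (G.card - 1) :=
      le_trans (by norm_num : (879 : ℝ) ≤ (11 / 7 : ℝ) ^ 15)
        (pow_le_pow_right₀ (by norm_num) (by omega))
    nlinarith
  have h2 : (F.filter (fun x => ¬ Real.log (tripleHeight x : ℝ) <
      40 * Real.log K + 280 * Real.log 2)).card ≤ 7 := by
    set G := F.filter (fun x => ¬ Real.log (tripleHeight x : ℝ) <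
      40 * Real.log K + 280 * Real.log 2) with hG
    by_contra! hcard
    obtain ⟨a, ha, b, hb, hab⟩ := hgap G (Finset.filter_subset _ _)
      (Finset.card_pos.mp (by omega))
    have ha' := not_lt.mp (Finset.mem_filter.mp ha).2
    have haF := (Finset.mem_filter.mp ha).1
    have hbF := (Finset.mem_filter.mp hb).1
    have hle := le_of_forall_pade hl hk ha' (h' := Real.log (tripleHeight b)) fun n =>
      HasPattern.pade hP hS (hF a haF).1 (hF b hbF).1 (hF' a haF b hbF) (hF a haF).2.1 hc
        (hF a haF).2.2.2 (hF b hbF).2.2.2 n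
    have hpow : (23.6 : ℝ) ≤ (11 / 7 : ℝ) ^ (G.card - 1) :=
      le_trans (by norm_num : (23.6 : ℝ) ≤ (11 / 7 : ℝ) ^ 7)
        (pow_le_pow_right₀ (by norm_num) (by omega))
    nlinarith
  omega

lemma exists_le_sum_eq {ι : Type*} [Fintype ι] (f : ι → ℕ) {n : ℕ} (hn : n ≤ ∑ i, f i) :
    ∃ g ≤ f, ∑ i, g i = n := by
  classical
  induction n with
  | zero => exact ⟨0, fun _ => Nat.zero_le _, by simp⟩
  | succ n ih =>
    obtain ⟨g, hg, rfl⟩ := ih (by omega)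
    obtain ⟨i, -, hi⟩ := Finset.exists_lt_of_sum_lt (Nat.lt_of_succ_le hn)
    refine ⟨g + Pi.single i 1, fun j => ?_, by simp [Finset.sum_add_distrib]⟩
    by_cases h : j = i
    · subst h; simpa using hi
    · simpa [h] using hg j

/-- The patterns sufficing to describe every triple. -/
noncomputable def patterns (S : Finset ℕ) : Finset (Option S → ℕ × Fin 3) :=
  {c ∈ Fintype.piFinset fun _ => insert (0, 0) (Finset.Icc 1 (6 * S.card) ×ˢ Finset.univ) |
    ∑ v, (c v).1 = 6 * S.card}

lemma IsTriple.exists_hasPattern {S : Finset ℕ} (hP : ∀ p ∈ S, p.Prime) (hS : S.Nonempty)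
    {x : Fin 3 → ℤ} (hx : IsTriple x) :
    ∃ c ∈ patterns S, HasPattern (outPart S (x 0 * x 1 * x 2).natAbs) x c := by
  have hsum := hx.sum_localLog hP
  set L := ∑ v : Option S, localLog x v with hL
  have hLpos : 0 < L := Finset.sum_pos' (fun v _ => hx.localLog_nonneg v)
    ⟨none, Finset.mem_univ _, hx.localLog_none_pos⟩
  have ht := hS.card_pos
  set f : Option S → ℕ := fun v => ⌊7 * S.card * localLog x v / L⌋₊ with hf
  have hf0 : ∀ v, 0 ≤ 7 * S.card * localLog x v / L := fun v =>
    div_nonneg (mul_nonneg (by positivity) (hx.localLog_nonneg v)) hLpos.le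
  have hfsum : 6 * S.card ≤ ∑ v, f v := by
    have h1 : ∑ v : Option S, 7 * S.card * localLog x v / L < ∑ v, ((f v : ℝ) + 1) :=
      Finset.sum_lt_sum_of_nonempty Finset.univ_nonempty fun v _ => Nat.lt_floor_add_one _
    rw [← Finset.sum_div, ← Finset.mul_sum, ← hL, mul_div_cancel_right₀ _ hLpos.ne',
      Finset.sum_add_distrib] at h1
    simp only [Finset.sum_const, Finset.card_univ, Fintype.card_option, Fintype.card_coe,
      nsmul_eq_mul, mul_one] at h1
    have h2 : 7 * S.card < ∑ v, f v + (S.card + 1) := by exact_mod_cast h1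
    omega
  obtain ⟨g, hg, hgsum⟩ := exists_le_sum_eq f hfsum
  choose i hi using hx.exists_isSmallAt hP
  refine ⟨fun v => (g v, if g v = 0 then 0 else i v), ?_, fun v => ⟨?_, fun h => ?_⟩⟩
  · simp only [patterns, Finset.mem_filter, Fintype.mem_piFinset, hgsum, and_true]
    intro v
    by_cases h : g v = 0
    · simp [h]
    · have := Finset.single_le_sum (f := g) (fun _ _ => Nat.zero_le _) (Finset.mem_univ v)
      simp [h]
      omega
  · rw [← hsum, ← le_div_iff₀ hLpos]
    exact (Nat.cast_le.mpr (hg v)).trans (Nat.floor_le (hf0 v))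
  · simp only at h ⊢
    rw [if_neg h]
    exact hi v

lemma sum_Icc_pow_le (n : ℕ) : ∑ j ∈ Finset.Icc 1 n, (6 / 7 : ℚ) ^ j ≤ 6 := by
  have : ∑ j ∈ Finset.Icc 1 n, (6 / 7 : ℚ) ^ j = 6 - 6 * (6 / 7) ^ n := by
    induction n with
    | zero => simp
    | succ n ih => rw [Finset.sum_Icc_succ_top (by omega), ih]; ring
  rw [this]
  have : (0 : ℚ) ≤ (6 / 7) ^ n := by positivity
  linarith

lemma card_patterns_le (S : Finset ℕ) : (patterns S).card ≤ 19 * 49 ^ S.card := by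
  have h1 : ((patterns S).card : ℚ) * (6 / 7) ^ (6 * S.card) ≤ 19 ^ (S.card + 1) := by
    calc ((patterns S).card : ℚ) * (6 / 7) ^ (6 * S.card)
        = ∑ c ∈ patterns S, ∏ v, (6 / 7 : ℚ) ^ (c v).1 := by
          rw [← nsmul_eq_mul, ← Finset.sum_const]
          refine Finset.sum_congr rfl fun c hc => ?_
          rw [Finset.prod_pow_eq_pow_sum, (Finset.mem_filter.mp hc).2]
      _ ≤ ∑ c ∈ Fintype.piFinset fun _ : Option S =>
            insert ((0, 0) : ℕ × Fin 3) (Finset.Icc 1 (6 * S.card) ×ˢ Finset.univ),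
            ∏ v, (6 / 7 : ℚ) ^ (c v).1 :=
          Finset.sum_le_sum_of_subset_of_nonneg (Finset.filter_subset _ _)
            fun _ _ _ => by positivity
      _ ≤ ∏ _v : Option S, 19 := by
          rw [← Finset.prod_univ_sum (fun _ : Option S => insert ((0, 0) : ℕ × Fin 3)
            (Finset.Icc 1 (6 * S.card) ×ˢ Finset.univ)) (fun _ d => (6 / 7 : ℚ) ^ d.1)]
          refine Finset.prod_le_prod (fun _ _ => by positivity) fun _ _ => ?_
          rw [Finset.sum_insert (by simp), Finset.sum_product_right]
          have := sum_Icc_pow_le (6 * S.card)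
          simp only [Finset.sum_const, Finset.card_univ, Fintype.card_fin, nsmul_eq_mul]
          push_cast
          linarith
      _ = 19 ^ (S.card + 1) := by simp
  have h2 : (19 : ℚ) ^ (S.card + 1) ≤ 19 * 49 ^ S.card * (6 / 7) ^ (6 * S.card) := by
    rw [pow_mul, mul_assoc, ← mul_pow, pow_succ']
    gcongr
    norm_num
  exact_mod_cast le_of_mul_le_mul_right (h1.trans h2) (by positivity)

lemma card_le_of_height_lt (F : Finset (Fin 3 → ℤ))
    (hF : ∀ x ∈ F, IsTriple x ∧ tripleHeight x < 32) : F.card ≤ 3969 := by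
  have := Finset.card_le_card_of_injOn (s := F)
    (t := Finset.Icc (-31 : ℤ) 31 ×ˢ Finset.Icc (-31 : ℤ) 31) (fun x => (x 0, x 1))
    (fun x hx => by
      have h := (hF x hx).2
      have h0 := abs_le.mp (abs_le_tripleHeight x 0)
      have h1 := abs_le.mp (abs_le_tripleHeight x 1)
      simp only [Finset.coe_product, Finset.coe_Icc, Set.mem_prod, Set.mem_Icc]
      omega)
    (fun x hx y hy hxy => by
      have hx' := (hF x hx).1.sum_eq
      have hy' := (hF y hy).1.sum_eq
      simp only [Prod.mk.injEq] at hxy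
      ext i
      fin_cases i
      · exact hxy.1
      · exact hxy.2
      · show x 2 = y 2
        omega)
  simpa using this

/-- The number of triples with prescribed valuations outside `S`. -/
lemma card_le_of_sameOutside {S : Finset ℕ} (hP : ∀ p ∈ S, p.Prime) (hS : S.Nonempty)
    (F : Finset (Fin 3 → ℤ)) (hF : ∀ x ∈ F, IsTriple x)
    (hF' : ∀ x ∈ F, ∀ y ∈ F, SameOutside S x y) : F.card ≤ 3 * 7 ^ (2 * S.card + 3) := by
  classical
  have hsmall := card_le_of_height_lt (F.filter (tripleHeight · < 32)) fun x hx =>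
    ⟨hF x (Finset.mem_filter.mp hx).1, (Finset.mem_filter.mp hx).2⟩
  have hlarge : (F.filter (¬ tripleHeight · < 32)).card ≤ 22 * (patterns S).card := by
    have h := fun x hx => (hF x hx).exists_hasPattern hP hS
    choose! c hc hc' using h
    refine Finset.card_le_mul_card_image_of_maps_to (f := c)
      (fun x hx => hc x (Finset.mem_filter.mp hx).1) 22 fun b hb => ?_
    rcases Finset.eq_empty_or_nonempty
      ((F.filter (¬ tripleHeight · < 32)).filter (c · = b)) with h | ⟨y, hy⟩
    · rw [h]; simp
    simp only [Finset.mem_filter] at hy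
    refine card_le_of_hasPattern hP hS (K := outPart S (y 0 * y 1 * y 2).natAbs)
      (Finset.mem_filter.mp hb).2 _ (fun x hx => ?_) fun x hx z hz => ?_
    · simp only [Finset.mem_filter] at hx
      have hK := (hF' x hx.1.1 y hy.1.1).outPart_eq (hF x hx.1.1) (hF y hy.1.1)
      exact ⟨hF x hx.1.1, hK, not_lt.mp hx.1.2, hK ▸ hx.2 ▸ hc' x hx.1.1⟩
    · exact hF' x (by simp_all) z (by simp_all)
  have h3 := card_patterns_le S
  have h4 : 49 ≤ 49 ^ S.card := Nat.le_self_pow hS.card_pos.ne' _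
  rw [← Finset.card_filter_add_card_filter_not (tripleHeight · < 32), pow_add, pow_mul]
  norm_num only
  omega

/-- The triple attached to `r`, encoding the equation `r + (1 - r) = 1`. -/
def ratTriple (r : ℚ) : Fin 3 → ℤ := ![r.num, r.den - r.num, -r.den]

lemma isTriple_ratTriple {r : ℚ} (h0 : r ≠ 0) (h1 : r ≠ 1) : IsTriple (ratTriple r) where
  sum_eq := by simp [ratTriple]
  ne_zero i := by
    fin_cases i
    · simpa [ratTriple] using h0
    · simp only [ratTriple]
      intro h
      apply h1
      have : (r.den : ℤ) = r.num := by simpa [sub_eq_zero] using h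
      rw [← Rat.num_div_den r, ← this]
      simp
    · simp [ratTriple]
  coprime := by
    have h : IsCoprime r.num (r.den : ℤ) := Rat.isCoprime_num_den r
    have h2 : IsCoprime r.num (r.den - r.num : ℤ) := by
      simpa [sub_eq_add_neg] using h.add_mul_left_right (-1)
    have h3 : IsCoprime (r.den - r.num : ℤ) (-r.den : ℤ) := by
      have := (h.neg_left.add_mul_left_left 1).neg_right
      rwa [mul_one, neg_add_eq_sub] at this
    intro i j hij
    fin_cases i <;> fin_cases j
    all_goals first
      | exact absurd rfl hij
      | exact h2
      | exact h.neg_right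
      | exact h2.symm
      | exact h3
      | exact h.neg_right.symm
      | exact h3.symm
  neg := by simp [ratTriple, r.den_pos]

lemma ratTriple_injective : Function.Injective ratTriple := fun r s h => by
  have h0 := congrFun h 0
  have h2 := congrFun h 2
  simp only [ratTriple, Matrix.cons_val] at h0 h2
  exact Rat.ext h0 (by omega)

lemma factorization_num_den (q : ℚ) {p : ℕ} (hp : p.Prime) :
    q.num.natAbs.factorization p = (padicValRat p q).toNat ∧
      q.den.factorization p = (-padicValRat p q).toNat := by
  rw [Nat.factorization_def _ hp, Nat.factorization_def _ hp, padicValRat_def, padicValInt]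
  have : padicValNat p q.num.natAbs = 0 ∨ padicValNat p q.den = 0 := by
    by_contra! h
    exact hp.not_dvd_one (q.reduced ▸ Nat.dvd_gcd (dvd_of_one_le_padicValNat (by omega))
      (dvd_of_one_le_padicValNat (by omega)))
  omega

lemma num_one_sub (r : ℚ) : (1 - r).num = r.den - r.num := by
  have hd : (1 - r).den = r.den := by simp
  have h := Rat.mul_den_eq_num (1 - r)
  rw [hd, sub_mul, one_mul, Rat.mul_den_eq_num] at h
  exact_mod_cast h.symm

lemma IsSUnit.padicValRat_eq_zero {S : Finset ℕ} {u : ℚ} (hu : IsSUnit S u) {p : ℕ}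
    (hp : p.Prime) (hpS : p ∉ S) : padicValRat p u = 0 := by
  have hn : ¬ p ∣ u.num.natAbs := fun h => hpS (hu.2 p hp (.inl (Int.natCast_dvd.mpr h)))
  have hd : ¬ p ∣ u.den := fun h => hpS (hu.2 p hp (.inr h))
  rw [padicValRat_def, padicValInt, padicValNat.eq_zero_of_not_dvd hn,
    padicValNat.eq_zero_of_not_dvd hd]
  simp

lemma sameOutside_ratTriple {S : Finset ℕ} {a b x y x' y' : ℚ} (ha : a ≠ 0) (hb : b ≠ 0)
    (hx : IsSUnit S x) (hy : IsSUnit S y) (hx' : IsSUnit S x') (hy' : IsSUnit S y')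
    (h : a * x + b * y = 1) (h' : a * x' + b * y' = 1) :
    SameOutside S (ratTriple (a * x)) (ratTriple (a * x')) := by
  intro p hp hpS i
  have : Fact p.Prime := ⟨hp⟩
  have ex : padicValRat p (a * x) = padicValRat p (a * x') := by
    rw [padicValRat.mul ha hx.1, padicValRat.mul ha hx'.1, hx.padicValRat_eq_zero hp hpS,
      hx'.padicValRat_eq_zero hp hpS]
  have ey : padicValRat p (1 - a * x) = padicValRat p (1 - a * x') := by
    rw [← h, add_sub_cancel_left, h, ← h', add_sub_cancel_left,
      padicValRat.mul hb hy.1, padicValRat.mul hb hy'.1, hy.padicValRat_eq_zero hp hpS,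
      hy'.padicValRat_eq_zero hp hpS]
  fin_cases i
  · simp [ratTriple, (factorization_num_den _ hp).1, ex]
  · simp [ratTriple, ← num_one_sub, (factorization_num_den _ hp).1, ey]
  · simp [ratTriple, (factorization_num_den _ hp).2, ex]

theorem stmt_7 (S : Finset ℕ) (hS : S.Nonempty) (hP : ∀ p ∈ S, p.Prime)
    (a b : ℚ) (ha : a ≠ 0) (hb : b ≠ 0) :
    {xy : ℚ × ℚ | IsSUnit S xy.1 ∧ IsSUnit S xy.2 ∧ a * xy.1 + b * xy.2 = 1}.Finite ∧
    {xy : ℚ × ℚ | IsSUnit S xy.1 ∧ IsSUnit S xy.2 ∧ a * xy.1 + b * xy.2 = 1}.ncard ≤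
      3 * 7 ^ (2 * S.card + 3) := by
  set A := {xy : ℚ × ℚ | IsSUnit S xy.1 ∧ IsSUnit S xy.2 ∧ a * xy.1 + b * xy.2 = 1} with hA
  have hcard : ∀ F : Finset (ℚ × ℚ), ↑F ⊆ A → F.card ≤ 3 * 7 ^ (2 * S.card + 3) := by
    classical
    intro F hF
    have hinj : Set.InjOn (fun xy : ℚ × ℚ => ratTriple (a * xy.1)) F := by
      intro u hu v hv huv
      have h1 := mul_left_cancel₀ ha (ratTriple_injective huv)
      refine Prod.ext h1 (mul_left_cancel₀ hb ?_)
      have h2 := (hF hu).2.2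
      have h3 := (hF hv).2.2
      rw [h1] at h2
      linarith
    rw [← Finset.card_image_of_injOn hinj]
    refine card_le_of_sameOutside hP hS _ (fun z hz => ?_) fun z hz w hw => ?_
    · obtain ⟨u, hu, rfl⟩ := Finset.mem_image.mp hz
      obtain ⟨h1, h2, h3⟩ := hF hu
      refine isTriple_ratTriple (mul_ne_zero ha h1.1) fun h => mul_ne_zero hb h2.1 ?_
      linarith
    · obtain ⟨u, hu, rfl⟩ := Finset.mem_image.mp hz
      obtain ⟨v, hv, rfl⟩ := Finset.mem_image.mp hw
      exact sameOutside_ratTriple ha hb (hF hu).1 (hF hu).2.1 (hF hv).1 (hF hv).2.1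
        (hF hu).2.2 (hF hv).2.2
  have hfin : A.Finite := by
    by_contra h
    obtain ⟨F, hFA, hF⟩ := Set.Infinite.exists_subset_card_eq h (3 * 7 ^ (2 * S.card + 3) + 1)
    have := hcard F hFA
    omega
  refine ⟨hfin, ?_⟩
  rw [Set.ncard_eq_toFinset_card A hfin]
  exact hcard _ (by simp)
end
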